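/- arXiv:2203.04247 — 5 statements merged into one kernel-verified Lean document; each statement's English description precedes it below -/
import Mathlib

section
/- Let 0 < γ < mn and p⃗ a vector of exponents, and suppose δ = γ - n/p = 1. Let w be a measurable function on ℝ^n that is positive and finite a.e., and let v_1,…,v_m be measurable functions with values in (0,∞]. If (w,v⃗) satisfies the ℍ_m(p⃗,γ,1) condition, then there exists an index j, 1 ≤ j ≤ m, with v_j = ∞ a.e. (equivalently v_j^{-1} = 0 a.e.). -/
open MeasureTheory Metric Set
open scoped ENNReal NNReal BigOperators Classical

noncomputable section

/-- Euclidean `n`-space. -/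
abbrev Rn (n : ℕ) := EuclideanSpace ℝ (Fin n)

/-- The conjugate exponent in `ℝ≥0∞`. -/
def conjE (q : ℝ≥0∞) : ℝ≥0∞ :=
  if q = 1 then ∞ else if q = ∞ then 1
  else ENNReal.ofReal (q.toReal / (q.toReal - 1))

/-- An `L^q`-type quantity on the set `s` for an `ℝ≥0∞`-valued function `g`:
the usual integral expression for `q < ∞`, and the essential supremum for `q = ∞`. -/
def lpOn {n : ℕ} (q : ℝ≥0∞) (g : Rn n → ℝ≥0∞) (s : Set (Rn n)) : ℝ≥0∞ :=
  if q = ∞ then essSup g (volume.restrict s)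
  else (∫⁻ y in s, g y ^ q.toReal) ^ (1 / q.toReal)

/-- A weight: measurable, positive and finite a.e., and locally integrable. -/
def IsWeight {n : ℕ} (u : Rn n → ℝ≥0∞) : Prop :=
  Measurable u ∧ (∀ᵐ x ∂(volume : Measure (Rn n)), 0 < u x ∧ u x < ∞) ∧
    ∀ (x : Rn n) (R : ℝ), 0 < R → ∫⁻ y in ball x R, u y < ∞

/-- The `i`-th factor in the `ℍ_m(p⃗,γ,δ)` condition, where `q = p_i'` is the
conjugate exponent of `p_i` (an essential supremum when `p_i = 1`). -/
def HmFactor {n : ℕ} (m : ℕ) (γi : ℝ) (q : ℝ≥0∞) (vi : Rn n → ℝ≥0∞)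
    (xB : Rn n) (R : ℝ) : ℝ≥0∞ :=
  lpOn q
    (fun y => (vi y)⁻¹ *
      (volume (ball xB R) ^ ((n : ℝ)⁻¹) + edist xB y) ^
        (-((n : ℝ) - γi + 1 / (m : ℝ))))
    Set.univ

/-- The class `ℍ_m(p⃗,γ,δ)` for a pair `(w, v⃗)`. -/
def Hm {n : ℕ} (m : ℕ) (γv : Fin m → ℝ) (δ : ℝ) (p : Fin m → ℝ≥0∞)
    (w : Rn n → ℝ≥0∞) (v : Fin m → Rn n → ℝ≥0∞) : Prop :=
  ∃ C : ℝ, 0 < C ∧ ∀ (xB : Rn n) (R : ℝ), 0 < R →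
    essSup w (volume.restrict (ball xB R)) *
        volume (ball xB R) ^ (-((δ - 1) / (n : ℝ))) *
        ∏ i, HmFactor m (γv i) (conjE (p i)) (v i) xB R
      ≤ ENNReal.ofReal C

/-- The global condition associated to `ℍ_m(p⃗,γ,δ)`. -/
def GlobalCond {n : ℕ} (m : ℕ) (γv : Fin m → ℝ) (δ : ℝ) (p : Fin m → ℝ≥0∞)
    (w : Rn n → ℝ≥0∞) (v : Fin m → Rn n → ℝ≥0∞) : Prop :=
  ∃ C : ℝ, 0 < C ∧ ∀ (xB : Rn n) (R : ℝ), 0 < R →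
    essSup w (volume.restrict (ball xB R)) *
        volume (ball xB R) ^ (-((δ - 1) / (n : ℝ))) *
        ∏ i, lpOn (conjE (p i))
          (fun y => (v i y)⁻¹ * edist xB y ^ (-((n : ℝ) - γv i + 1 / (m : ℝ))))
          (ball xB R)ᶜ
      ≤ ENNReal.ofReal C

/-- The local condition associated to `ℍ_m(p⃗,γ,δ)`. -/
def LocalCond {n : ℕ} (m : ℕ) (γ δ : ℝ) (p : Fin m → ℝ≥0∞)
    (w : Rn n → ℝ≥0∞) (v : Fin m → Rn n → ℝ≥0∞) : Prop :=
  ∃ C : ℝ, 0 < C ∧ ∀ (xB : Rn n) (R : ℝ), 0 < R →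
    essSup w (volume.restrict (ball xB R)) *
        volume (ball xB R) ^
          (-(δ / (n : ℝ)) + γ / (n : ℝ) - ∑ i, ((p i)⁻¹).toReal) *
        ∏ i, (volume (ball xB R) ^ (-(((conjE (p i))⁻¹).toReal)) *
          lpOn (conjE (p i)) (fun y => (v i y)⁻¹) (ball xB R))
      ≤ ENNReal.ofReal C

/-- The reverse Hölder class `RH_s`. -/
def memRH {n : ℕ} (s : ℝ) (u : Rn n → ℝ≥0∞) : Prop :=
  ∃ C : ℝ, 0 < C ∧ ∀ (x : Rn n) (R : ℝ), 0 < R →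
    ((volume (ball x R))⁻¹ * ∫⁻ y in ball x R, u y ^ s) ^ (1 / s) ≤
      ENNReal.ofReal C * ((volume (ball x R))⁻¹ * ∫⁻ y in ball x R, u y)

/-- The reverse Hölder class `RH_∞`. -/
def memRHinf {n : ℕ} (u : Rn n → ℝ≥0∞) : Prop :=
  ∃ C : ℝ, 0 < C ∧ ∀ (x : Rn n) (R : ℝ), 0 < R →
    essSup u (volume.restrict (ball x R)) ≤
      ENNReal.ofReal C * ((volume (ball x R))⁻¹ * ∫⁻ y in ball x R, u y)

/-- Doubling condition for an `ℝ≥0∞`-valued weight. -/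
def IsDoubling {n : ℕ} (u : Rn n → ℝ≥0∞) : Prop :=
  ∃ C : ℝ, 0 < C ∧ ∀ (x : Rn n) (R : ℝ), 0 < R →
    ∫⁻ y in ball x (2 * R), u y ≤ ENNReal.ofReal C * ∫⁻ y in ball x R, u y

/-- The multilinear class `A_{p⃗,∞}`. -/
def ApInfty {n : ℕ} (m : ℕ) (p : Fin m → ℝ≥0∞) (v : Fin m → Rn n → ℝ≥0∞) : Prop :=
  ∃ C : ℝ, 0 < C ∧ ∀ (xB : Rn n) (R : ℝ), 0 < R →
    essSup (fun x => ∏ i, v i x) (volume.restrict (ball xB R)) *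
        ∏ i, (volume (ball xB R) ^ (-(((conjE (p i))⁻¹).toReal)) *
          lpOn (conjE (p i)) (fun y => (v i y)⁻¹) (ball xB R))
      ≤ ENNReal.ofReal C

/-- The kernel of the modified multilinear fractional operator `J_{γ,m}`. -/
def Jker {n : ℕ} (m : ℕ) (γ : ℝ) (x : Rn n) (y : Fin m → Rn n) : ℝ :=
  (∑ i, dist x (y i)) ^ (γ - (m : ℝ) * (n : ℝ)) -
    (if ∀ i, y i ∈ ball (0 : Rn n) 1 then 0
     else (∑ i, dist (0 : Rn n) (y i)) ^ (γ - (m : ℝ) * (n : ℝ)))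

/-- The modified multilinear fractional operator `J_{γ,m}`. -/
def Jop {n m : ℕ} (γ : ℝ) (f : Fin m → Rn n → ℝ) (x : Rn n) : ℝ :=
  ∫ y : Fin m → Rn n, Jker m γ x y * ∏ i, f i (y i)

/-- The vector `(1,…,1)` in `ℝⁿ`. -/
def uvec (n : ℕ) : Rn n := (EuclideanSpace.equiv (Fin n) ℝ).symm fun _ => 1

/-- The quadrant `A` associated to a ball with center `xB`. -/
def Aset {n : ℕ} (xB : Rn n) : Set (Rn n) := {y | ∀ i, xB i ≤ y i}

/-- The set `C₁` associated to a ball `B(xB,R)`. -/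
def C1set {n : ℕ} (xB : Rn n) (R : ℝ) : Set (Rn n) :=
  ball (xB - (R / (12 * Real.sqrt n)) • uvec n) (R / (12 * Real.sqrt n)) ∩
    {y | ∀ i, y i ≤ (xB - (R / (12 * Real.sqrt n)) • uvec n) i}

/-- The set `C₂` associated to a ball `B(xB,R)`. -/
def C2set {n : ℕ} (xB : Rn n) (R : ℝ) : Set (Rn n) :=
  ball (xB - (R / (3 * Real.sqrt n)) • uvec n) (2 * R / 3) ∩
    {y | ∀ i, y i ≤ (xB - (R / (3 * Real.sqrt n)) • uvec n) i}

open Filter Topology in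
theorem aux_vol_tendsto {n : ℕ} (hn : 1 ≤ n) (x : Rn n) :
    Tendsto (fun r : ℝ => volume (closedBall x r)) (𝓝[>] 0) (𝓝 0) := by
  have h1 : Tendsto (fun r : ℝ => ENNReal.ofReal (r ^ n) * volume (ball (0 : Rn n) 1))
      (𝓝[>] 0) (𝓝 (ENNReal.ofReal ((0:ℝ) ^ n) * volume (ball (0 : Rn n) 1))) := by
    refine ENNReal.Tendsto.mul_const ?_ (Or.inr measure_ball_lt_top.ne)
    refine (ENNReal.continuous_ofReal.comp (continuous_pow n)).continuousAt.tendsto.mono_left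
      nhdsWithin_le_nhds
  have h0 : (0:ℝ) ^ n = 0 := zero_pow (by omega)
  rw [h0, ENNReal.ofReal_zero, zero_mul] at h1
  refine h1.congr' ?_
  filter_upwards [self_mem_nhdsWithin] with r hr
  rw [Measure.addHaar_closedBall _ _ (le_of_lt hr)]
  simp

open Filter Topology in
theorem aux_rho_tendsto {n : ℕ} (hn : 1 ≤ n) (x : Rn n) :
    Tendsto (fun r : ℝ => volume (ball x r) ^ ((n : ℝ)⁻¹)) (𝓝[>] 0) (𝓝 0) := by
  have h1 : Tendsto (fun r : ℝ => volume (ball x r)) (𝓝[>] 0) (𝓝 0) :=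
    tendsto_of_tendsto_of_tendsto_of_le_of_le tendsto_const_nhds (aux_vol_tendsto hn x)
      (fun _ => zero_le) (fun r => measure_mono ball_subset_closedBall)
  have h2 := (ENNReal.continuous_rpow_const (y := (n : ℝ)⁻¹)).continuousAt.tendsto.comp h1
  have hn' : (0:ℝ) < n := by exact_mod_cast hn
  rwa [ENNReal.zero_rpow_of_pos (inv_pos.2 hn')] at h2

theorem aux_rpow_anti {a b : ℝ≥0∞} (h : a ≤ b) {t : ℝ} (ht : 0 ≤ t) : b ^ (-t) ≤ a ^ (-t) := by
  rw [ENNReal.rpow_neg, ENNReal.rpow_neg]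
  exact ENNReal.inv_le_inv.2 (ENNReal.rpow_le_rpow h ht)

theorem aux_essSup_ge {n : ℕ} (g : Rn n → ℝ≥0∞) (s t : Set (Rn n)) (c : ℝ≥0∞)
    (hts : t ⊆ s) (ht : volume t ≠ 0) (h : ∀ y ∈ t, c ≤ g y) :
    c ≤ essSup g (volume.restrict s) := by
  by_contra hlt
  push Not at hlt
  apply ht
  have h1 : ∀ᵐ y ∂(volume.restrict s), g y ≤ essSup g (volume.restrict s) := ENNReal.ae_le_essSup g
  have h2 : ∀ᵐ y ∂(volume.restrict t), g y ≤ essSup g (volume.restrict s) :=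
    ae_restrict_of_ae_restrict_of_subset hts h1
  exfalso
  have h4 : volume.restrict t {y | ¬ g y ≤ essSup g (volume.restrict s)} = 0 := h2
  have h5 : t ∩ t ⊆ {y | ¬ g y ≤ essSup g (volume.restrict s)} ∩ t := fun y hy =>
    ⟨not_le.2 (hlt.trans_le (h y hy.1)), hy.1⟩
  have h6 := Measure.le_restrict_apply t {y | ¬ g y ≤ essSup g (volume.restrict s)} (μ := volume)
  have h7 := measure_mono (μ := volume) h5
  rw [inter_self] at h7
  exact ht (le_antisymm ((h7.trans h6).trans h4.le) zero_le)

open Filter Topology in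
theorem aux_density {n : ℕ} (E : Set (Rn n)) (hE : MeasurableSet E) (hpos : volume E ≠ 0) :
    ∃ x : Rn n, ∃ r0 : ℝ, 0 < r0 ∧ ∀ r, 0 < r → r ≤ r0 →
      volume (closedBall x r) / 2 ≤ volume (E ∩ closedBall x r) := by
  have h := Besicovitch.ae_tendsto_measure_inter_div_of_measurableSet
    (volume : Measure (Rn n)) hE
  have : ∃ x ∈ E, Tendsto (fun r => volume (E ∩ closedBall x r) / volume (closedBall x r))
      (𝓝[>] 0) (𝓝 (E.indicator 1 x)) := by
    by_contra hcon
    push Not at hcon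
    exact hpos (measure_mono_null (fun x hx => hcon x hx) h)
  obtain ⟨x, hx, ht⟩ := this
  rw [indicator_of_mem hx, Pi.one_apply] at ht
  have hev := ht.eventually (lt_mem_nhds (show (2:ℝ≥0∞)⁻¹ < 1 from ENNReal.inv_lt_one.2 (by norm_num)))
  obtain ⟨u, hu, hu2⟩ := mem_nhdsGT_iff_exists_Ioc_subset.1 hev
  refine ⟨x, u, hu, fun r hr hru => ?_⟩
  have h1 : (2:ℝ≥0∞)⁻¹ < volume (E ∩ closedBall x r) / volume (closedBall x r) := hu2 ⟨hr, hru⟩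
  have h2 := ENNReal.mul_le_of_le_div h1.le
  rwa [mul_comm, ← div_eq_mul_inv] at h2

theorem aux_vol_pos {n : ℕ} (x : Rn n) {r : ℝ} (hr : 0 < r) : volume (closedBall x r) / 2 ≠ 0 := by
  have := (measure_closedBall_pos (volume : Measure (Rn n)) x hr).ne'
  simp [ENNReal.div_eq_zero_iff, this]

open Filter Topology in
theorem aux_blow {n : ℕ} (hn : 1 ≤ n) (m : ℕ) (γi : ℝ) (q : ℝ≥0∞) (vi : Rn n → ℝ≥0∞)
    (hvm : Measurable vi) (hv : ∀ x, 0 < vi x) (hq : 1 ≤ q)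
    (hθ : 0 < (n : ℝ) - γi + 1 / (m : ℝ))
    (hθq : q ≠ ∞ → (n : ℝ) ≤ ((n : ℝ) - γi + 1 / (m : ℝ)) * q.toReal)
    (E : Set (Rn n)) (hE : MeasurableSet E) (M : ℝ≥0∞) (hM : M ≠ ∞) (hEM : ∀ y ∈ E, vi y ≤ M)
    (x : Rn n) (r0 : ℝ) (hr0 : 0 < r0)
    (hd : ∀ r, 0 < r → r ≤ r0 → volume (closedBall x r) / 2 ≤ volume (E ∩ closedBall x r))
    (K : ℝ≥0∞) (hK : K ≠ ∞) (h : ∀ R, 0 < R → R ≤ 1 → HmFactor m γi q vi x R ≤ K) : False := by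
  unfold HmFactor at h
  set θ := (n : ℝ) - γi + 1 / (m : ℝ) with hθdef
  have hev : ∀ᶠ r : ℝ in 𝓝[>] 0, r ∈ Ioc 0 (min r0 1) :=
    Ioc_mem_nhdsGT (lt_min hr0 one_pos)
  have hρ := aux_rho_tendsto hn x
  have hMi : M⁻¹ ≠ 0 := ENNReal.inv_ne_zero.2 hM
  have hE0 : E.Nonempty := by
    by_contra hne
    rw [not_nonempty_iff_eq_empty] at hne
    have := hd r0 hr0 le_rfl
    rw [hne, empty_inter, measure_empty] at this
    exact aux_vol_pos x hr0 (le_antisymm this zero_le)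
  have hM0 : M ≠ 0 := by
    obtain ⟨y, hy⟩ := hE0
    exact ((hv y).trans_le (hEM y hy)).ne'
  have hMi' : M⁻¹ ≠ ∞ := ENNReal.inv_ne_top.2 hM0
  by_cases hqt : q = ∞
  · have ht : Tendsto (fun r : ℝ => M⁻¹ * (volume (ball x r) ^ ((n : ℝ)⁻¹) + ENNReal.ofReal r) ^ (-θ))
        (𝓝[>] 0) (𝓝 (M⁻¹ * (0 + ENNReal.ofReal 0) ^ (-θ))) := by
      refine ((ENNReal.continuous_const_mul hMi').continuousAt.tendsto).comp ?_
      refine (ENNReal.continuous_rpow_const.continuousAt.tendsto).comp ?_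
      exact hρ.add (ENNReal.continuous_ofReal.continuousAt.tendsto.mono_left nhdsWithin_le_nhds)
    rw [ENNReal.ofReal_zero, add_zero, ENNReal.zero_rpow_of_neg (by linarith),
      ENNReal.mul_top hMi] at ht
    have hle : ∞ ≤ K := by
      refine le_of_tendsto ht ?_
      filter_upwards [hev] with r hr
      refine le_trans ?_ (h r hr.1 (hr.2.trans (min_le_right _ _)))
      rw [lpOn, if_pos hqt]
      refine aux_essSup_ge _ _ (E ∩ closedBall x r) _ (subset_univ _) ?_ ?_
      · intro h0
        have := hd r hr.1 (hr.2.trans (min_le_left _ _))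
        rw [h0] at this
        exact aux_vol_pos x hr.1 (le_antisymm this zero_le)
      · intro y hy
        refine mul_le_mul' (ENNReal.inv_le_inv.2 (hEM y hy.1)) (aux_rpow_anti ?_ hθ.le)
        gcongr
        rw [edist_comm, edist_dist]
        exact ENNReal.ofReal_le_ofReal hy.2
    exact hK (top_le_iff.1 hle)
  · have hθq := hθq hqt
    have hq0 : 0 < q.toReal := ENNReal.toReal_pos (by positivity) hqt
    set G : Rn n → ℝ≥0∞ := fun y => ((vi y)⁻¹ * (edist x y) ^ (-θ)) ^ q.toReal with hG
    set Gr : ℝ → Rn n → ℝ≥0∞ := fun r y =>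
      ((vi y)⁻¹ * (volume (ball x r) ^ ((n : ℝ)⁻¹) + edist x y) ^ (-θ)) ^ q.toReal with hGr
    have hmeas : ∀ r, Measurable (Gr r) := by
      intro r
      simp only [hGr]
      fun_prop
    have hGm : Measurable G := by
      simp only [hG]
      fun_prop
    have hlim : ∀ y, Tendsto (fun r => Gr r y) (𝓝[>] 0) (𝓝 (G y)) := by
      intro y
      refine (ENNReal.continuous_rpow_const.continuousAt.tendsto).comp ?_
      refine ((ENNReal.continuous_const_mul
        (ENNReal.inv_ne_top.2 (hv y).ne')).continuousAt.tendsto).comp ?_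
      refine (ENNReal.continuous_rpow_const.continuousAt.tendsto).comp ?_
      have := hρ.add (tendsto_const_nhds (x := edist x y))
      rwa [zero_add] at this
    have hfin : ∫⁻ y, G y ≤ K ^ q.toReal := by
      have hF := lintegral_liminf_le (μ := volume) (u := 𝓝[>] (0:ℝ)) hmeas
      have e : ∀ y, liminf (fun r => Gr r y) (𝓝[>] 0) = G y := fun y => (hlim y).liminf_eq
      simp only [e] at hF
      refine hF.trans ?_
      refine liminf_le_of_frequently_le' (Eventually.frequently ?_)
      filter_upwards [hev] with r hr
      have := h r hr.1 (hr.2.trans (min_le_right _ _))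
      rw [lpOn, if_neg hqt, Measure.restrict_univ, one_div] at this
      exact (ENNReal.rpow_inv_le_iff hq0).1 this
    have hfin' : ∫⁻ y, G y ≠ ∞ :=
      (hfin.trans_lt (ENNReal.rpow_lt_top_of_nonneg hq0.le hK)).ne
    have hT := tendsto_setLIntegral_zero hfin' (aux_vol_tendsto hn x)
    set c := (M⁻¹) ^ q.toReal * (volume (ball (0 : Rn n) 1) / 2) with hc
    have hc0 : c ≠ 0 := by
      have h1 : (M⁻¹) ^ q.toReal ≠ 0 := by
        rw [Ne, ENNReal.rpow_eq_zero_iff_of_pos hq0]; exact hMi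
      have h2 := (measure_ball_pos (volume : Measure (Rn n)) 0 one_pos).ne'
      refine mul_ne_zero h1 ?_
      simp [ENNReal.div_eq_zero_iff, h2]
    have hcle : c ≤ 0 := by
      refine ge_of_tendsto hT ?_
      filter_upwards [hev] with r hr
      have hr1 : r ≤ 1 := hr.2.trans (min_le_right _ _)
      have hd1 := hd r hr.1 (hr.2.trans (min_le_left _ _))
      have step : (M⁻¹ * (ENNReal.ofReal r) ^ (-θ)) ^ q.toReal * volume (E ∩ closedBall x r)
          ≤ ∫⁻ y in closedBall x r, G y := by
        rw [← setLIntegral_const]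
        refine (setLIntegral_mono hGm ?_).trans (lintegral_mono_set inter_subset_right)
        intro y hy
        refine ENNReal.rpow_le_rpow ?_ hq0.le
        refine mul_le_mul' (ENNReal.inv_le_inv.2 (hEM y hy.1)) (aux_rpow_anti ?_ hθ.le)
        rw [edist_comm, edist_dist]
        exact ENNReal.ofReal_le_ofReal hy.2
      refine le_trans ?_ step
      refine le_trans ?_ (mul_le_mul_right hd1 _)
      rw [Measure.addHaar_closedBall _ _ hr.1.le, ENNReal.mul_rpow_of_nonneg _ _ hq0.le,
        ← ENNReal.rpow_mul, ENNReal.ofReal_rpow_of_pos hr.1, finrank_euclideanSpace, Fintype.card_fin]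
      have h1 : (1:ℝ≥0∞) ≤ ENNReal.ofReal (r ^ (-θ * q.toReal)) * ENNReal.ofReal (r ^ n) := by
        rw [← ENNReal.ofReal_mul (Real.rpow_nonneg hr.1.le _), ← Real.rpow_natCast r n,
          ← Real.rpow_add hr.1]
        rw [← ENNReal.ofReal_one]
        refine ENNReal.ofReal_le_ofReal ?_
        exact Real.one_le_rpow_of_pos_of_le_one_of_nonpos hr.1 hr1 (by linarith)
      calc c = c * 1 := (mul_one _).symm
        _ ≤ c * (ENNReal.ofReal (r ^ (-θ * q.toReal)) * ENNReal.ofReal (r ^ n)) := by gcongr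
        _ = _ := by rw [hc]; simp only [div_eq_mul_inv]; ring
    exact hc0 (le_antisymm hcle zero_le)

theorem aux_anti {n : ℕ} (m : ℕ) (γi : ℝ) (q : ℝ≥0∞) (vi : Rn n → ℝ≥0∞)
    (hθ : 0 < (n : ℝ) - γi + 1 / (m : ℝ)) (x : Rn n) {R : ℝ} (hR : R ≤ 1) :
    HmFactor m γi q vi x 1 ≤ HmFactor m γi q vi x R := by
  have key : ∀ y, (vi y)⁻¹ * (volume (ball x 1) ^ ((n : ℝ)⁻¹) + edist x y) ^
        (-((n : ℝ) - γi + 1 / (m : ℝ))) ≤ (vi y)⁻¹ * (volume (ball x R) ^ ((n : ℝ)⁻¹) + edist x y) ^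
        (-((n : ℝ) - γi + 1 / (m : ℝ))) := by
    intro y
    refine mul_le_mul' le_rfl (aux_rpow_anti ?_ hθ.le)
    refine add_le_add (ENNReal.rpow_le_rpow (measure_mono (ball_subset_ball hR)) (by positivity)) le_rfl
  unfold HmFactor lpOn
  split_ifs
  · exact essSup_mono_ae (Filter.Eventually.of_forall key)
  · refine ENNReal.rpow_le_rpow (lintegral_mono fun y => ?_) (by positivity)
    exact ENNReal.rpow_le_rpow (key y) (by positivity)

theorem aux_pos {n : ℕ} (m : ℕ) (γi : ℝ) (q : ℝ≥0∞) (vi : Rn n → ℝ≥0∞)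
    (hvm : Measurable vi) (hq : 1 ≤ q) (hθ : 0 < (n : ℝ) - γi + 1 / (m : ℝ)) (x : Rn n)
    (hne : ¬ ∀ᵐ y ∂(volume : Measure (Rn n)), vi y = ∞) :
    HmFactor m γi q vi x 1 ≠ 0 := by
  intro h0
  apply hne
  have hb : ∀ y, (volume (ball x 1) ^ ((n : ℝ)⁻¹) + edist x y) ^
        (-((n : ℝ) - γi + 1 / (m : ℝ))) ≠ 0 := by
    intro y
    rw [ENNReal.rpow_neg]
    refine ENNReal.inv_ne_zero.2 (ENNReal.rpow_ne_top_of_nonneg hθ.le ?_)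
    exact ENNReal.add_ne_top.2 ⟨ENNReal.rpow_ne_top_of_nonneg (by positivity)
      measure_ball_lt_top.ne, edist_ne_top _ _⟩
  unfold HmFactor lpOn at h0
  split_ifs at h0 with hq1
  · rw [Measure.restrict_univ, ENNReal.essSup_eq_zero_iff] at h0
    filter_upwards [h0] with y hy
    have := (mul_eq_zero.1 hy).resolve_right (hb y)
    exact ENNReal.inv_eq_zero.1 this
  · have hq0 : 0 < q.toReal := ENNReal.toReal_pos (by positivity) hq1
    rw [Measure.restrict_univ, ENNReal.rpow_eq_zero_iff_of_pos (by positivity),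
      lintegral_eq_zero_iff (by fun_prop)] at h0
    filter_upwards [h0] with y hy
    have hy' := (ENNReal.rpow_eq_zero_iff_of_pos hq0).1 hy
    have := (mul_eq_zero.1 hy').resolve_right (hb y)
    exact ENNReal.inv_eq_zero.1 this

theorem aux_conj {q : ℝ≥0∞} (hq : 1 ≤ q) :
    1 ≤ conjE q ∧ (conjE q)⁻¹.toReal = 1 - (q⁻¹).toReal := by
  unfold conjE
  split_ifs with h1 h2
  · simp [h1]
  · simp [h2]
  · have hr : 1 < q.toReal := by
      have : (1:ℝ≥0∞) < q := lt_of_le_of_ne hq (Ne.symm h1)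
      simpa using (ENNReal.toReal_lt_toReal (by simp) h2).2 this
    constructor
    · rw [ENNReal.one_le_ofReal, le_div_iff₀ (by linarith)]; linarith
    · rw [ENNReal.toReal_inv, ENNReal.toReal_ofReal (div_nonneg (by linarith) (by linarith)),
        ENNReal.toReal_inv]
      have : q.toReal - 1 ≠ 0 := by linarith
      field_simp

/-- if `δ = γ - n/p = 1`, the `ℍ_m(p⃗,γ,1)` condition forces
`v_j = ∞` almost everywhere for some `j`. -/
theorem statement3 {n m : ℕ} (hn : 1 ≤ n) (hm : 1 ≤ m) (γ : ℝ) (hγ0 : 0 < γ)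
    (hγ : γ < m * n) (γv : Fin m → ℝ) (hγv : ∀ i, 0 < γv i ∧ γv i < n)
    (hγsum : ∑ i, γv i = γ) (p : Fin m → ℝ≥0∞) (hp : ∀ i, 1 ≤ p i)
    (hδ : γ - n * ∑ i, ((p i)⁻¹).toReal = 1)
    (w : Rn n → ℝ≥0∞) (hwm : Measurable w)
    (hw : ∀ᵐ x ∂(volume : Measure (Rn n)), 0 < w x ∧ w x < ∞)
    (v : Fin m → Rn n → ℝ≥0∞) (hvm : ∀ i, Measurable (v i))
    (hv : ∀ i x, 0 < v i x)
    (hH : Hm m γv 1 p w v) :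
    ∃ j, ∀ᵐ x ∂(volume : Measure (Rn n)), v j x = ∞ := by
  classical
  by_contra hcon
  have hne : ∀ j, ¬ ∀ᵐ y ∂(volume : Measure (Rn n)), v j y = ∞ := not_exists.1 hcon
  have hn' : (0:ℝ) < n := by exact_mod_cast hn
  have hm' : (0:ℝ) < m := by exact_mod_cast hm
  have hθ : ∀ i, 0 < (n : ℝ) - γv i + 1 / (m : ℝ) := by
    intro i
    have h1 := (hγv i).2
    have h2 : 0 < 1 / (m : ℝ) := by positivity
    linarith
  have hconj := fun i => aux_conj (hp i)
  -- choose the index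
  obtain ⟨i, hi⟩ : ∃ i, (n : ℝ) * ((conjE (p i))⁻¹).toReal ≤ (n : ℝ) - γv i + 1 / (m : ℝ) := by
    by_contra hno
    push Not at hno
    have hne' : (Finset.univ : Finset (Fin m)).Nonempty := ⟨⟨0, hm⟩, Finset.mem_univ _⟩
    have hlt := Finset.sum_lt_sum_of_nonempty hne' (fun i _ => hno i)
    simp only [(hconj _).2] at hlt
    rw [← Finset.mul_sum, Finset.sum_sub_distrib, Finset.sum_add_distrib,
      Finset.sum_sub_distrib, hγsum] at hlt
    simp only [Finset.sum_const, Finset.card_univ, Fintype.card_fin, nsmul_eq_mul] at hlt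
    have : (m : ℝ) * (1 / m) = 1 := by field_simp
    nlinarith
  have hθq : conjE (p i) ≠ ∞ →
      (n : ℝ) ≤ ((n : ℝ) - γv i + 1 / (m : ℝ)) * (conjE (p i)).toReal := by
    intro ht
    have hq0 : 0 < (conjE (p i)).toReal :=
      ENNReal.toReal_pos (lt_of_lt_of_le one_pos (hconj i).1).ne' ht
    rw [ENNReal.toReal_inv, ← div_eq_mul_inv, div_le_iff₀ hq0] at hi
    exact hi
  -- the good set
  let E : ℕ → Set (Rn n) := fun k => {y | v i y ≤ k} ∩ {y | ((k : ℝ≥0∞) + 1)⁻¹ ≤ w y}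
  have hEm : ∀ k, MeasurableSet (E k) := fun k =>
    (measurableSet_le (hvm i) measurable_const).inter (measurableSet_le measurable_const hwm)
  obtain ⟨k, hk⟩ : ∃ k, volume (E k) ≠ 0 := by
    by_contra hno
    push Not at hno
    apply hne i
    have hU : volume (⋃ k, E k) = 0 := measure_iUnion_null hno
    filter_upwards [hw, measure_eq_zero_iff_ae_notMem.1 hU] with y hy1 hy2
    by_contra hy3
    apply hy2
    obtain ⟨a, ha⟩ := ENNReal.exists_nat_gt hy3
    obtain ⟨b, hb⟩ := ENNReal.exists_inv_nat_lt hy1.1.ne'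
    refine mem_iUnion.2 ⟨max a b, ?_, ?_⟩
    · exact ha.le.trans (by exact_mod_cast le_max_left a b)
    · refine le_trans (ENNReal.inv_le_inv.2 ?_) hb.le
      exact_mod_cast (le_max_right a b).trans (Nat.le_succ _)
  obtain ⟨x, r0, hr0, hd⟩ := aux_density (E k) (hEm k) hk
  obtain ⟨C, hC, hCb⟩ := hH
  set ε : ℝ≥0∞ := ((k : ℝ≥0∞) + 1)⁻¹ with hε
  have hε0 : ε ≠ 0 := ENNReal.inv_ne_zero.2 (by finiteness)
  set P : ℝ≥0∞ := ∏ j ∈ Finset.univ.erase i, HmFactor m (γv j) (conjE (p j)) (v j) x 1 with hP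
  have hP0 : P ≠ 0 := Finset.prod_ne_zero_iff.2 fun j _ =>
    aux_pos m (γv j) _ (v j) (hvm j) (hconj j).1 (hθ j) x (hne j)
  have hbound : ∀ R, 0 < R → R ≤ 1 →
      HmFactor m (γv i) (conjE (p i)) (v i) x R ≤ ENNReal.ofReal C / (ε * P) := by
    intro R hR hR1
    have h1 := hCb x R hR
    rw [sub_self, zero_div, neg_zero, ENNReal.rpow_zero, mul_one,
      ← Finset.mul_prod_erase _ _ (Finset.mem_univ i)] at h1
    have h2 : P ≤ ∏ j ∈ Finset.univ.erase i, HmFactor m (γv j) (conjE (p j)) (v j) x R :=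
      Finset.prod_le_prod' fun j _ => aux_anti m (γv j) _ (v j) (hθ j) x hR1
    have h3 : ε ≤ essSup w (volume.restrict (ball x R)) := by
      have hs : 0 < min r0 (R / 2) := lt_min hr0 (by linarith)
      refine aux_essSup_ge w _ (E k ∩ closedBall x (min r0 (R / 2))) _ ?_ ?_ ?_
      · refine inter_subset_right.trans (closedBall_subset_ball ?_)
        exact (min_le_right _ _).trans_lt (by linarith)
      · intro h0
        have := hd _ hs (min_le_left _ _)
        rw [h0] at this
        exact aux_vol_pos x hs (le_antisymm this zero_le)
      · intro y hy
        exact hy.1.2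
    rw [ENNReal.le_div_iff_mul_le (Or.inl (mul_ne_zero hε0 hP0)) (Or.inr ENNReal.ofReal_ne_top)]
    calc _ = ε * (HmFactor m (γv i) (conjE (p i)) (v i) x R * P) := by ring
      _ ≤ _ := mul_le_mul' h3 (mul_le_mul' le_rfl h2)
      _ ≤ _ := h1
  exact aux_blow hn m (γv i) (conjE (p i)) (v i) (hvm i) (hv i) (hconj i).1 (hθ i) hθq (E k)
    (hEm k) k (ENNReal.natCast_ne_top k) (fun y hy => hy.1) x r0 hr0 hd _
    (ENNReal.div_ne_top ENNReal.ofReal_ne_top (mul_ne_zero hε0 hP0)) hbound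
end
end

section
/- Let 0 < γ < mn, p⃗ a vector of exponents, and δ < γ - mn. Let w be a nonnegative measurable function on ℝ^n and v_1,…,v_m measurable functions with values in (0,∞]. If (w,v⃗) satisfies the ℍ_m(p⃗,γ,δ) condition, then either w = 0 a.e. or there exists an index i, 1 ≤ i ≤ m, with v_i = ∞ a.e. (equivalently v_i^{-1} = 0 a.e.). -/
open MeasureTheory Metric Set
open scoped ENNReal NNReal BigOperators Classical

noncomputable section

lemma aux_conjE_pos {q : ℝ≥0∞} (hq : 1 ≤ q) (h : conjE q ≠ ∞) : 0 < (conjE q).toReal := by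
  unfold conjE at h ⊢
  split_ifs at h ⊢ with h1 h2
  · exact absurd rfl h
  · simp
  · have h3 : 1 < q.toReal := by
      have : (1 : ℝ≥0∞) < q := lt_of_le_of_ne hq (Ne.symm h1)
      have := (ENNReal.toReal_lt_toReal ENNReal.one_ne_top h2).2 this
      simpa using this
    have h4 : 0 < q.toReal / (q.toReal - 1) := div_pos (by linarith) (by linarith)
    rw [ENNReal.toReal_ofReal h4.le]
    exact h4

lemma aux_lpOn_mono {n : ℕ} {q : ℝ≥0∞} {f g : Rn n → ℝ≥0∞} (s : Set (Rn n))
    (h : ∀ y, f y ≤ g y) : lpOn q f s ≤ lpOn q g s := by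
  unfold lpOn
  split_ifs with h1
  · exact essSup_mono_ae (Filter.Eventually.of_forall h)
  · apply ENNReal.rpow_le_rpow _ (by positivity)
    exact lintegral_mono fun y => ENNReal.rpow_le_rpow (h y) (by positivity)

lemma aux_lpOn_const_mul {n : ℕ} {q : ℝ≥0∞} (hq : q ≠ ∞ → 0 < q.toReal) (c : ℝ≥0∞)
    (hc : c ≠ ∞) (g : Rn n → ℝ≥0∞) (s : Set (Rn n)) :
    lpOn q (fun y => c * g y) s = c * lpOn q g s := by
  unfold lpOn
  split_ifs with h1
  · exact ENNReal.essSup_const_mul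
  · have h2 := hq h1
    simp_rw [ENNReal.mul_rpow_of_nonneg _ _ h2.le]
    rw [lintegral_const_mul' _ _ (ENNReal.rpow_ne_top_of_nonneg h2.le hc),
      ENNReal.mul_rpow_of_nonneg _ _ (by positivity), ← ENNReal.rpow_mul,
      mul_one_div_cancel h2.ne', ENNReal.rpow_one]

lemma aux_lpOn_zero {n : ℕ} {q : ℝ≥0∞} (hq : q ≠ ∞ → 0 < q.toReal)
    {g : Rn n → ℝ≥0∞} (hg : Measurable g) (h : lpOn q g univ = 0) :
    ∀ᵐ y ∂(volume : Measure (Rn n)), g y = 0 := by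
  unfold lpOn at h
  rw [Measure.restrict_univ] at h
  split_ifs at h with h1
  · exact ENNReal.essSup_eq_zero_iff.1 h
  · have h2 := hq h1
    rw [ENNReal.rpow_eq_zero_iff_of_pos (by positivity),
      lintegral_eq_zero_iff (hg.pow_const _)] at h
    filter_upwards [h] with y hy
    exact (ENNReal.rpow_eq_zero_iff_of_pos h2).1 hy

lemma aux_prod_rpow {ι : Type*} (t : Finset ι) (a : ℝ≥0∞) (h0 : a ≠ 0) (h1 : a ≠ ∞)
    (f : ι → ℝ) : ∏ i ∈ t, a ^ f i = a ^ ∑ i ∈ t, f i := by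
  induction t using Finset.induction_on with
  | empty => simp
  | insert i t hi ih => rw [Finset.prod_insert hi, Finset.sum_insert hi, ih,
      ENNReal.rpow_add _ _ h0 h1]

lemma aux_kernel {a d : ℝ≥0∞} (ha : 1 ≤ a) (ha' : a ≠ ∞) {s : ℝ} (hs : 0 < s) :
    a ^ (-s) * (1 + d) ^ (-s) ≤ (a + d) ^ (-s) := by
  rw [← ENNReal.mul_rpow_of_ne_zero (by positivity) (by simp),
    ENNReal.rpow_neg, ENNReal.rpow_neg, ENNReal.inv_le_inv]
  apply ENNReal.rpow_le_rpow _ hs.le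
  rw [mul_add, mul_one]
  gcongr
  exact le_mul_of_one_le_left zero_le ha

/-- if `δ < γ - mn`, the `ℍ_m(p⃗,γ,δ)` condition forces `w = 0` a.e.
or `v_i = ∞` a.e. for some `i`. -/
theorem statement4 {n m : ℕ} (hn : 1 ≤ n) (hm : 1 ≤ m) (γ : ℝ) (hγ0 : 0 < γ)
    (hγ : γ < m * n) (γv : Fin m → ℝ) (hγv : ∀ i, 0 < γv i ∧ γv i < n)
    (hγsum : ∑ i, γv i = γ) (δ : ℝ) (p : Fin m → ℝ≥0∞) (hp : ∀ i, 1 ≤ p i)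
    (hδ : δ < γ - m * n)
    (w : Rn n → ℝ≥0∞) (hwm : Measurable w)
    (v : Fin m → Rn n → ℝ≥0∞) (hvm : ∀ i, Measurable (v i))
    (hv : ∀ i x, 0 < v i x)
    (hH : Hm m γv δ p w v) :
    (∀ᵐ x ∂(volume : Measure (Rn n)), w x = 0) ∨
      ∃ i, ∀ᵐ x ∂(volume : Measure (Rn n)), v i x = ∞ := by
  by_contra hcon
  push Not at hcon
  obtain ⟨hw, hvn⟩ := hcon
  obtain ⟨C, hC, hH⟩ := hH
  have hn0 : (0 : ℝ) < n := by exact_mod_cast hn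
  have hm0 : (0 : ℝ) < m := by exact_mod_cast hm
  let s : Fin m → ℝ := fun i => (n : ℝ) - γv i + 1 / (m : ℝ)
  have hs : ∀ i, 0 < s i := fun i => by
    have := (hγv i).2
    have h2 : 0 < 1 / (m : ℝ) := by positivity
    simp only [s]; linarith
  have hsum : ∑ i, -(s i) = -(m * n - γ + 1) := by
    rw [Finset.sum_neg_distrib]
    simp only [s, Finset.sum_add_distrib, Finset.sum_sub_distrib, hγsum]
    simp
    field_simp
  have hq : ∀ i, conjE (p i) ≠ ∞ → 0 < (conjE (p i)).toReal := fun i => aux_conjE_pos (hp i)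
  let g : Fin m → Rn n → ℝ≥0∞ := fun i y => (v i y)⁻¹ * (1 + edist (0 : Rn n) y) ^ (-(s i))
  have hg : ∀ i, Measurable (g i) := fun i =>
    (hvm i).inv.mul ((measurable_const.add measurable_edist_right).pow_const _)
  let L : Fin m → ℝ≥0∞ := fun i => lpOn (conjE (p i)) (g i) univ
  have hL : ∀ i, L i ≠ 0 := by
    intro i h
    apply hvn i
    filter_upwards [aux_lpOn_zero (hq i) (hg i) h] with y hy
    rcases mul_eq_zero.1 hy with h1 | h1
    · exact not_not.2 (ENNReal.inv_eq_zero.1 h1)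
    · exfalso
      rw [ENNReal.rpow_neg, ENNReal.inv_eq_zero, ENNReal.rpow_eq_top_iff_of_pos (hs i)] at h1
      simp at h1
  obtain ⟨N0, hN0⟩ : ∃ N : ℕ, essSup w (volume.restrict (ball (0 : Rn n) N)) ≠ 0 := by
    by_contra hall
    push Not at hall
    apply hw
    have h1 : ∀ N : ℕ, ∀ᵐ x ∂(volume : Measure (Rn n)), x ∈ ball (0 : Rn n) N → w x = 0 := by
      intro N
      exact (ae_restrict_iff' measurableSet_ball).1 (ENNReal.essSup_eq_zero_iff.1 (hall N))
    filter_upwards [ae_all_iff.2 h1] with x hx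
    obtain ⟨N, hN⟩ := exists_nat_gt (dist x 0)
    exact not_not.2 (hx N hN)
  set W := essSup w (volume.restrict (ball (0 : Rn n) N0)) with hW
  let ε : ℝ := γ - m * n - δ
  have hε : 0 < ε := by simp only [ε]; linarith
  let a : ℕ → ℝ≥0∞ := fun N => volume (ball (0 : Rn n) N) ^ ((n : ℝ)⁻¹)
  have : Nonempty (Fin n) := ⟨⟨0, hn⟩⟩
  have ha : Filter.Tendsto a Filter.atTop (nhds ∞) := by
    have h1 : Filter.Tendsto (fun N : ℕ => volume (ball (0 : Rn n) N)) Filter.atTop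
        (nhds (volume (⋃ N : ℕ, ball (0 : Rn n) N))) :=
      tendsto_measure_iUnion_atTop fun i j hij => ball_subset_ball (by exact_mod_cast hij)
    rw [iUnion_ball_nat, measure_univ_of_isAddLeftInvariant] at h1
    have h2 := (ENNReal.continuous_rpow_const (y := (n : ℝ)⁻¹)).tendsto ∞ |>.comp h1
    rwa [ENNReal.top_rpow_of_pos (by positivity)] at h2
  have hatop : ∀ N, a N ≠ ∞ := fun N =>
    ENNReal.rpow_ne_top_of_nonneg (by positivity) measure_ball_lt_top.ne
  have hlim : Filter.Tendsto (fun N => (W * ∏ i, L i) * a N ^ ε) Filter.atTop (nhds ∞) := by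
    have h2 := (ENNReal.continuous_rpow_const (y := ε)).tendsto ∞ |>.comp ha
    rw [ENNReal.top_rpow_of_pos hε] at h2
    have hK : W * ∏ i, L i ≠ 0 := mul_ne_zero hN0 (Finset.prod_ne_zero_iff.2 fun i _ => hL i)
    have h3 := ENNReal.Tendsto.const_mul (a := W * ∏ i, L i) h2 (Or.inl ENNReal.top_ne_zero)
    rwa [ENNReal.mul_top hK] at h3
  have hev : ∀ᶠ N in Filter.atTop, (W * ∏ i, L i) * a N ^ ε ≤ ENNReal.ofReal C := by
    filter_upwards [Filter.eventually_ge_atTop N0, Filter.eventually_ge_atTop 1,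
      ha.eventually (lt_mem_nhds ENNReal.one_lt_top)] with N hN hN1 haN
    have hH' := hH 0 N (by exact_mod_cast hN1)
    refine le_trans ?_ hH'
    have ha0 : a N ≠ 0 := (zero_lt_one.trans haN).ne'
    have hvol : volume (ball (0 : Rn n) N) ^ (-((δ - 1) / (n : ℝ))) = a N ^ (1 - δ) := by
      simp only [a]
      rw [← ENNReal.rpow_mul]
      congr 1
      field_simp
      ring
    have hWle : W ≤ essSup w (volume.restrict (ball (0 : Rn n) N)) :=
      essSup_mono_measure' (Measure.restrict_mono
        (ball_subset_ball (by exact_mod_cast hN)) le_rfl)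
    have hfac : ∀ i, a N ^ (-(s i)) * L i
        ≤ HmFactor m (γv i) (conjE (p i)) (v i) (0 : Rn n) N := by
      intro i
      simp only [L]
      rw [← aux_lpOn_const_mul (hq i) _ (by
        simp [ENNReal.rpow_eq_top_iff, ha0, hatop N])]
      apply aux_lpOn_mono
      intro y
      have := aux_kernel (d := edist (0 : Rn n) y) haN.le (hatop N) (hs i)
      calc a N ^ (-(s i)) * g i y
          = (v i y)⁻¹ * (a N ^ (-(s i)) * (1 + edist (0 : Rn n) y) ^ (-(s i))) := by
            simp only [g]; ring
        _ ≤ _ := mul_le_mul_right this _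
    calc (W * ∏ i, L i) * a N ^ ε
        = W * a N ^ (1 - δ) * ∏ i, (a N ^ (-(s i)) * L i) := by
          rw [Finset.prod_mul_distrib, aux_prod_rpow _ _ ha0 (hatop N), hsum]
          have : ε = (1 - δ) + (-(m * n - γ + 1)) := by simp only [ε]; ring
          rw [this, ENNReal.rpow_add _ _ ha0 (hatop N)]
          ring
      _ ≤ _ := by
          rw [hvol]
          exact mul_le_mul' (mul_le_mul' hWle le_rfl)
            (Finset.prod_le_prod' fun i _ => hfac i)
  have := le_of_tendsto hlim hev
  simp at this
end
end

section
/- Let 0 < γ < mn, take γ_i = γ/m for every i, let p⃗ be a vector of exponents, and set τ = (γ-mn)(1-1/m)+1/m. Suppose γ - mn < δ < τ ≤ γ - n/p, let m_1 = #{i : p_i = 1} (so m_1 < m), and choose ε with 0 < ε < (mn-γ+δ)/(m-m_1). Define β_i = 0 if p_i = 1 and β_i = n/p_i' - ε otherwise, and α = Σ_{i=1}^m β_i + δ - γ + n/p (which is positive). Then the pair (w,v⃗) with w(x) = |x|^α and v_i(x) = |x|^{β_i} belongs to ℍ_m(p⃗,γ,δ). -/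
open MeasureTheory Metric Set
open scoped ENNReal NNReal BigOperators Classical

noncomputable section

lemma s13_scale {n : ℕ} (g : ℝ → ℝ) (hg0 : ∀ t, 0 ≤ t → 0 ≤ g t)
    (hint : Integrable (fun y : Rn n => g ‖y‖)) :
    ∃ K : ℝ, 0 < K ∧ ∀ (x : Rn n) (M : ℝ), 0 < M →
      ∫⁻ y, ENNReal.ofReal (g (M⁻¹ * ‖x - y‖)) ≤ ENNReal.ofReal (K * M ^ (n : ℝ)) := by
  have hI : 0 ≤ ∫ y : Rn n, g ‖y‖ := integral_nonneg fun y => hg0 _ (norm_nonneg _)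
  refine ⟨(∫ y : Rn n, g ‖y‖) + 1, by linarith, fun x M hM => ?_⟩
  have h1 : ∀ y : Rn n, g (M⁻¹ * ‖x - y‖) = g ‖M⁻¹ • (x - y)‖ := fun y => by
    rw [norm_smul, Real.norm_of_nonneg (by positivity)]
  simp_rw [h1]
  rw [lintegral_sub_left_eq_self (fun y : Rn n => ENNReal.ofReal (g ‖M⁻¹ • y‖)) x]
  have hint2 : Integrable (fun y : Rn n => g ‖M⁻¹ • y‖) :=
    hint.comp_smul (inv_ne_zero hM.ne')
  rw [← ofReal_integral_eq_lintegral_ofReal hint2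
    (Filter.Eventually.of_forall fun y => hg0 _ (norm_nonneg _))]
  apply ENNReal.ofReal_le_ofReal
  rw [Measure.integral_comp_inv_smul volume (fun y : Rn n => g ‖y‖) M]
  simp only [finrank_euclideanSpace, Fintype.card_fin, smul_eq_mul, Real.rpow_natCast]
  rw [abs_of_pos (by positivity)]
  have : 0 < M ^ n := by positivity
  nlinarith

lemma s13_int1 {n : ℕ} (hn : 1 ≤ n) (a k : ℝ) (ha : a < n) (hak : n < a + k) :
    Integrable (fun y : Rn n => ‖y‖ ^ (-a) * (1 + ‖y‖) ^ (-k)) := by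
  have : Nonempty (Fin n) := ⟨⟨0, hn⟩⟩
  have hk : 0 < k := by linarith
  rw [integrable_fun_norm_addHaar volume (f := fun t : ℝ => t ^ (-a) * (1 + t) ^ (-k))]
  simp only [finrank_euclideanSpace, Fintype.card_fin, smul_eq_mul]
  have e : ∀ t : ℝ, 0 < t → t ^ (n - 1) * (t ^ (-a) * (1 + t) ^ (-k))
      = t ^ ((n : ℝ) - 1 - a) * (1 + t) ^ (-k) := fun t ht => by
    rw [← mul_assoc, ← Real.rpow_natCast, ← Real.rpow_add ht]
    push_cast [hn]
    congr 2
  rw [integrableOn_congr_fun (fun t (ht : t ∈ Ioi 0) => e t ht) measurableSet_Ioi]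
  rw [← Ioc_union_Ioi_eq_Ioi (zero_le_one' ℝ)]
  have hmeas : Measurable (fun t : ℝ => t ^ ((n : ℝ) - 1 - a) * (1 + t) ^ (-k)) := by fun_prop
  apply IntegrableOn.union
  · have : IntegrableOn (fun t : ℝ => t ^ ((n : ℝ) - 1 - a)) (Ioc 0 1) := by
      rw [integrableOn_Ioc_iff_integrableOn_Ioo,
        intervalIntegral.integrableOn_Ioo_rpow_iff zero_lt_one]
      linarith
    refine this.mono' hmeas.aestronglyMeasurable ?_
    filter_upwards [ae_restrict_mem measurableSet_Ioc] with t ht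
    have h0 : 0 < t := ht.1
    rw [Real.norm_of_nonneg (by positivity)]
    exact mul_le_of_le_one_right (by positivity)
      (Real.rpow_le_one_of_one_le_of_nonpos (by linarith) (by linarith))
  · have : IntegrableOn (fun t : ℝ => t ^ ((n : ℝ) - 1 - a - k)) (Ioi 1) :=
      integrableOn_Ioi_rpow_of_lt (by linarith) zero_lt_one
    refine this.mono' hmeas.aestronglyMeasurable ?_
    filter_upwards [ae_restrict_mem measurableSet_Ioi] with t ht
    have h0 : 0 < t := lt_trans zero_lt_one ht
    rw [Real.norm_of_nonneg (by positivity), sub_eq_add_neg _ k, Real.rpow_add h0]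
    gcongr ?_ * ?_
    exact Real.rpow_le_rpow_of_nonpos h0 (by linarith) (by linarith)

lemma s13_int2 {n : ℕ} (hn : 1 ≤ n) (b : ℝ) (hb : b < n) :
    Integrable (fun y : Rn n => (Iio (3 : ℝ)).indicator (fun t => t ^ (-b)) ‖y‖) := by
  have : Nonempty (Fin n) := ⟨⟨0, hn⟩⟩
  have h : IntegrableOn (fun y : Rn n => ‖y‖ ^ (-b)) (ball 0 3) := by
    rw [integrableOn_fun_norm_addHaar volume (f := fun t : ℝ => t ^ (-b))]
    simp only [finrank_euclideanSpace, Fintype.card_fin, smul_eq_mul]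
    have e : ∀ t : ℝ, 0 < t → t ^ (n - 1) * t ^ (-b) = t ^ ((n : ℝ) - 1 - b) := fun t ht => by
      rw [← Real.rpow_natCast, ← Real.rpow_add ht]
      push_cast [hn]
      congr 1
    rw [integrableOn_congr_fun (fun t ht => e t ht.1) measurableSet_Ioo,
      intervalIntegral.integrableOn_Ioo_rpow_iff (by norm_num)]
    linarith
  rw [← integrable_indicator_iff measurableSet_ball] at h
  refine h.congr (Filter.Eventually.of_forall fun y => ?_)
  simp [indicator]

lemma s13_ae_ne {n : ℕ} (hn : 1 ≤ n) (x : Rn n) : ∀ᵐ y : Rn n, y ≠ x := by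
  have : Nonempty (Fin n) := ⟨⟨0, hn⟩⟩
  rw [ae_iff]
  simp

/-- the main integral estimate -/
lemma s13_main {n : ℕ} (hn : 1 ≤ n) (a b k : ℝ) (ha : a < n) (hak : n < a + k)
    (hb0 : 0 ≤ b) (hbk : b ≤ k) (hb : b < n) :
    ∃ K : ℝ, 0 < K ∧ ∀ (x : Rn n) (R : ℝ), 0 < R →
      ∫⁻ y, ENNReal.ofReal (‖y‖ ^ (-a) * (R + ‖x - y‖) ^ (-k)) ≤
        ENNReal.ofReal (K * ((‖x‖ + R) ^ (n - a - b) * R ^ (b - k))) := by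
  set g : ℝ → ℝ := fun t => t ^ (-a) * (1 + t) ^ (-k) with hg
  set h : ℝ → ℝ := (Iio (3 : ℝ)).indicator (fun t => t ^ (-b)) with hh
  have hg0 : ∀ t, 0 ≤ t → 0 ≤ g t := fun t ht => by simp only [hg]; positivity
  have hh0 : ∀ t, 0 ≤ t → 0 ≤ h t := fun t ht => by
    simp only [hh, indicator]; split_ifs <;> positivity
  obtain ⟨K1, hK1, H1⟩ := s13_scale g hg0 (s13_int1 hn a k ha hak)
  obtain ⟨K2, hK2, H2⟩ := s13_scale h hh0 (s13_int2 hn b hb)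
  have hk : 0 < k := by linarith
  have hgm : Measurable g := by simp only [hg]; fun_prop
  have hhm : Measurable h := by
    simp only [hh]; exact Measurable.indicator (by fun_prop) measurableSet_Iio
  refine ⟨4 ^ k * K1 + 4 ^ |a| * K2, by positivity, fun x R hR => ?_⟩
  set M := ‖x‖ + R with hM
  have hRM : R ≤ M := by have := norm_nonneg x; linarith
  have hM0 : 0 < M := by linarith
  have hpt : ∀ᵐ y : Rn n, ENNReal.ofReal (‖y‖ ^ (-a) * (R + ‖x - y‖) ^ (-k)) ≤
      ENNReal.ofReal (4 ^ k * M ^ (-a - k)) * ENNReal.ofReal (g (M⁻¹ * ‖0 - y‖)) +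
      ENNReal.ofReal (4 ^ |a| * M ^ (-a - b) * R ^ (b - k)) *
        ENNReal.ofReal (h (M⁻¹ * ‖x - y‖)) := by
    filter_upwards [s13_ae_ne hn x] with y hyx
    have hxy : 0 < ‖x - y‖ := norm_pos_iff.2 (sub_ne_zero.2 hyx.symm)
    have hg0' := hg0 (M⁻¹ * ‖0 - y‖) (by positivity)
    have hh0' := hh0 (M⁻¹ * ‖x - y‖) (by positivity)
    rw [← ENNReal.ofReal_mul (by positivity), ← ENNReal.ofReal_mul (by positivity),
      ← ENNReal.ofReal_add (by positivity) (by positivity)]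
    apply ENNReal.ofReal_le_ofReal
    have t1 : ‖x‖ ≤ ‖x - y‖ + ‖y‖ := by simpa using norm_add_le (x - y) y
    have t2 : ‖y‖ ≤ ‖x - y‖ + ‖x‖ := by
      have := norm_sub_le x (x - y); simp at this; linarith
    have t3 := norm_sub_le x y
    have hy0 := norm_nonneg y
    by_cases hc : M / 4 ≤ ‖y‖ ∧ ‖y‖ < 2 * M
    · have hyp : 0 < ‖y‖ := by linarith [hc.1]
      have e1 : h (M⁻¹ * ‖x - y‖) = M ^ b * ‖x - y‖ ^ (-b) := by
        have : M⁻¹ * ‖x - y‖ < 3 := by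
          rw [inv_mul_lt_iff₀ hM0]; linarith [hc.2]
        simp only [hh, indicator, mem_Iio, this, if_true]
        rw [Real.mul_rpow (by positivity) (by positivity), Real.inv_rpow hM0.le,
          Real.rpow_neg hM0.le, inv_inv]
      have e2 : ‖y‖ ^ (-a) ≤ 4 ^ |a| * M ^ (-a) := by
        rw [← div_le_iff₀ (by positivity), ← Real.div_rpow (by positivity) hM0.le]
        have u1 : 1 / 4 ≤ ‖y‖ / M := by rw [le_div_iff₀ hM0]; linarith [hc.1]
        have u2 : ‖y‖ / M ≤ 4 := by rw [div_le_iff₀ hM0]; linarith [hc.2]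
        rcases le_total 0 a with ha0 | ha0
        · rw [abs_of_nonneg ha0]
          calc (‖y‖ / M) ^ (-a) ≤ (1 / 4 : ℝ) ^ (-a) :=
                Real.rpow_le_rpow_of_nonpos (by norm_num) u1 (by linarith)
            _ = 4 ^ a := by
                rw [one_div, Real.inv_rpow (by norm_num), Real.rpow_neg (by norm_num), inv_inv]
        · rw [abs_of_nonpos ha0]
          exact Real.rpow_le_rpow (by positivity) u2 (by linarith)
      have e3 : (R + ‖x - y‖) ^ (-k) ≤ R ^ (b - k) * ‖x - y‖ ^ (-b) := by
        have : -k = (b - k) + -b := by ring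
        rw [this, Real.rpow_add (by positivity)]
        gcongr ?_ * ?_
        · exact Real.rpow_le_rpow_of_nonpos hR (by linarith) (by linarith)
        · exact Real.rpow_le_rpow_of_nonpos hxy (by linarith) (by linarith)
      have e4 : M ^ (-a - b) * M ^ b = M ^ (-a) := by
        rw [← Real.rpow_add hM0]; congr 1; ring
      calc ‖y‖ ^ (-a) * (R + ‖x - y‖) ^ (-k)
          ≤ (4 ^ |a| * M ^ (-a)) * (R ^ (b - k) * ‖x - y‖ ^ (-b)) := by gcongr
        _ = 4 ^ |a| * M ^ (-a - b) * R ^ (b - k) * h (M⁻¹ * ‖x - y‖) := by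
            rw [e1, ← e4]; ring
        _ ≤ _ := le_add_of_nonneg_left (by positivity)
    · have e0 : (M + ‖y‖) / 4 ≤ R + ‖x - y‖ := by
        by_cases h1 : M / 4 ≤ ‖y‖
        · have : 2 * M ≤ ‖y‖ := by
            by_contra h2; exact hc ⟨h1, not_le.1 h2⟩
          linarith
        · linarith [not_le.1 h1]
      have e1 : (R + ‖x - y‖) ^ (-k) ≤ 4 ^ k * (M + ‖y‖) ^ (-k) := by
        calc (R + ‖x - y‖) ^ (-k) ≤ ((M + ‖y‖) / 4) ^ (-k) :=
              Real.rpow_le_rpow_of_nonpos (by positivity) e0 (by linarith)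
          _ = _ := by
              rw [Real.div_rpow (by positivity) (by norm_num), Real.rpow_neg (by norm_num : (0:ℝ) ≤ 4)]
              field_simp
      have e2 : M ^ (-a - k) * g (M⁻¹ * ‖0 - y‖) = ‖y‖ ^ (-a) * (M + ‖y‖) ^ (-k) := by
        simp only [hg, zero_sub, norm_neg]
        have : 1 + M⁻¹ * ‖y‖ = M⁻¹ * (M + ‖y‖) := by field_simp
        rw [this, Real.mul_rpow (by positivity) (by positivity),
          Real.mul_rpow (by positivity) (by positivity), Real.inv_rpow hM0.le,
          Real.inv_rpow hM0.le, sub_eq_add_neg, Real.rpow_add hM0]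
        have p1 : 0 < M ^ (-a) := by positivity
        have p2 : 0 < M ^ (-k) := by positivity
        field_simp
      calc ‖y‖ ^ (-a) * (R + ‖x - y‖) ^ (-k)
          ≤ ‖y‖ ^ (-a) * (4 ^ k * (M + ‖y‖) ^ (-k)) := by gcongr
        _ = 4 ^ k * M ^ (-a - k) * g (M⁻¹ * ‖0 - y‖) := by
            rw [mul_assoc, e2]; ring
        _ ≤ _ := le_add_of_nonneg_right (by positivity)
  have q1 : M ^ (-a - k) * M ^ (n : ℝ) ≤ M ^ (n - a - b) * R ^ (b - k) := by
    rw [← Real.rpow_add hM0]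
    have : -a - k + (n : ℝ) = (n - a - b) + (b - k) := by ring
    rw [this, Real.rpow_add hM0]
    gcongr ?_ * ?_
    exact Real.rpow_le_rpow_of_nonpos hR hRM (by linarith)
  have q2 : M ^ (-a - b) * M ^ (n : ℝ) = M ^ (n - a - b) := by
    rw [← Real.rpow_add hM0]; congr 1; ring
  calc _ ≤ _ := lintegral_mono_ae hpt
    _ = ENNReal.ofReal (4 ^ k * M ^ (-a - k)) * (∫⁻ y : Rn n, ENNReal.ofReal (g (M⁻¹ * ‖0 - y‖))) +
      ENNReal.ofReal (4 ^ |a| * M ^ (-a - b) * R ^ (b - k)) *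
        ∫⁻ y : Rn n, ENNReal.ofReal (h (M⁻¹ * ‖x - y‖)) := by
        rw [lintegral_add_left (by fun_prop), lintegral_const_mul _ (by fun_prop),
          lintegral_const_mul _ (by fun_prop)]
    _ ≤ ENNReal.ofReal (4 ^ k * M ^ (-a - k)) * ENNReal.ofReal (K1 * M ^ (n : ℝ)) +
      ENNReal.ofReal (4 ^ |a| * M ^ (-a - b) * R ^ (b - k)) *
        ENNReal.ofReal (K2 * M ^ (n : ℝ)) := by
        gcongr
        · exact H1 0 M hM0
        · exact H2 x M hM0
    _ ≤ _ := by
        rw [← ENNReal.ofReal_mul (by positivity), ← ENNReal.ofReal_mul (by positivity),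
          ← ENNReal.ofReal_add (by positivity) (by positivity)]
        apply ENNReal.ofReal_le_ofReal
        calc 4 ^ k * M ^ (-a - k) * (K1 * M ^ (n : ℝ)) +
              4 ^ |a| * M ^ (-a - b) * R ^ (b - k) * (K2 * M ^ (n : ℝ))
            = 4 ^ k * K1 * (M ^ (-a - k) * M ^ (n : ℝ)) +
              4 ^ |a| * K2 * ((M ^ (-a - b) * M ^ (n : ℝ)) * R ^ (b - k)) := by ring
          _ ≤ 4 ^ k * K1 * (M ^ (n - a - b) * R ^ (b - k)) +
              4 ^ |a| * K2 * (M ^ (n - a - b) * R ^ (b - k)) := by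
              rw [q2]; gcongr
          _ = _ := by ring

lemma s13_conj_inv (p : ℝ≥0∞) (hp : 1 ≤ p) :
    ((conjE p)⁻¹).toReal = 1 - (p⁻¹).toReal := by
  unfold conjE
  split_ifs with h1 h2
  · simp [h1]
  · simp [h2]
  · have h3 : 1 < p.toReal := by
      rw [← ENNReal.toReal_one]
      exact (ENNReal.toReal_lt_toReal (by simp) h2).2 (lt_of_le_of_ne hp (Ne.symm h1))
    have h4 : 0 < p.toReal - 1 := by linarith
    rw [ENNReal.toReal_inv, ENNReal.toReal_inv, ENNReal.toReal_ofReal (by positivity)]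
    field_simp

lemma s13_conj_ne_top (p : ℝ≥0∞) (hp1 : p ≠ 1) : conjE p ≠ ∞ := by
  unfold conjE
  rw [if_neg hp1]
  split_ifs <;> simp

lemma s13_conj_pos (p : ℝ≥0∞) (hp : 1 ≤ p) (hp1 : p ≠ 1) : 0 < (conjE p).toReal := by
  unfold conjE
  rw [if_neg hp1]
  split_ifs with h2
  · simp
  · have h3 : 1 < p.toReal := by
      rw [← ENNReal.toReal_one]
      exact (ENNReal.toReal_lt_toReal (by simp) h2).2 (lt_of_le_of_ne hp (Ne.symm hp1))
    have h4 : 0 < p.toReal - 1 := by linarith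
    rw [ENNReal.toReal_ofReal (by positivity)]
    positivity

lemma s13_vol {n : ℕ} (hn : 1 ≤ n) : ∃ c : ℝ, 0 < c ∧ ∀ (x : Rn n) (R s : ℝ), 0 < R →
    volume (ball x R) ^ s = ENNReal.ofReal ((c * R) ^ (n * s)) := by
  have hn0 : (n : ℝ) ≠ 0 := by positivity
  set V := (volume (ball (0 : Rn n) 1)).toReal with hV
  have hVt : volume (ball (0 : Rn n) 1) ≠ ∞ := measure_ball_lt_top.ne
  have hV0 : 0 < V := ENNReal.toReal_pos (measure_ball_pos _ _ one_pos).ne' hVt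
  refine ⟨V ^ ((n : ℝ)⁻¹), by positivity, fun x R s hR => ?_⟩
  rw [Measure.addHaar_ball_of_pos _ _ hR, ← ENNReal.ofReal_toReal hVt,
    ← ENNReal.ofReal_mul (by positivity), ENNReal.ofReal_rpow_of_pos (by positivity),
    finrank_euclideanSpace, Fintype.card_fin]
  congr 1
  rw [Real.rpow_mul (by positivity), Real.mul_rpow (by positivity) hR.le,
    ← Real.rpow_mul hV0.le, inv_mul_cancel₀ hn0, Real.rpow_one, Real.rpow_natCast, mul_comm]

/-- the base of the kernel as a real number -/
lemma s13_base {n : ℕ} (hn : 1 ≤ n) : ∃ c : ℝ, 0 < c ∧ ∀ (x y : Rn n) (R κ : ℝ), 0 < R →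
    0 ≤ κ → (volume (ball x R) ^ ((n : ℝ)⁻¹) + edist x y) ^ (-κ) ≤
      ENNReal.ofReal (c ^ (-κ) * (R + ‖x - y‖) ^ (-κ)) := by
  obtain ⟨c, hc, H⟩ := s13_vol hn
  have hn0 : (n : ℝ) ≠ 0 := by positivity
  refine ⟨min c 1, by positivity, fun x y R κ hR hκ => ?_⟩
  rw [H x R _ hR, mul_inv_cancel₀ hn0, Real.rpow_one, edist_dist, dist_eq_norm,
    ← ENNReal.ofReal_add (by positivity) (by positivity),
    ENNReal.ofReal_rpow_of_pos (by positivity), ← Real.mul_rpow (by positivity) (by positivity)]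
  apply ENNReal.ofReal_le_ofReal
  apply Real.rpow_le_rpow_of_nonpos (by positivity) _ (by linarith)
  have h1 : min c 1 * R ≤ c * R := by gcongr; exact min_le_left _ _
  have h2 : min c 1 * ‖x - y‖ ≤ ‖x - y‖ :=
    mul_le_of_le_one_left (norm_nonneg _) (min_le_right _ _)
  linarith

lemma s13_factor_top {n m : ℕ} (hn : 1 ≤ n) (γi κ : ℝ) (hκ : κ = (n : ℝ) - γi + 1 / (m : ℝ))
    (hκ0 : 0 ≤ κ) : ∃ K : ℝ, 0 < K ∧ ∀ (x : Rn n) (R : ℝ), 0 < R →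
      HmFactor m γi ∞ (fun y : Rn n => ENNReal.ofReal (‖y‖ ^ (0 : ℝ))) x R ≤
        ENNReal.ofReal (K * R ^ (-κ)) := by
  obtain ⟨c, hc, H⟩ := s13_base hn
  refine ⟨c ^ (-κ), by positivity, fun x R hR => ?_⟩
  unfold HmFactor lpOn
  rw [if_pos rfl, ← hκ]
  refine essSup_le_of_ae_le _ ?_
  refine Filter.Eventually.of_forall fun y => ?_
  simp only [Real.rpow_zero, ENNReal.ofReal_one, inv_one, one_mul]
  refine (H x y R κ hR hκ0).trans (ENNReal.ofReal_le_ofReal ?_)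
  gcongr ?_ * ?_
  exact Real.rpow_le_rpow_of_nonpos hR (by linarith [norm_nonneg (x - y)]) (by linarith)

lemma s13_factor {n m : ℕ} (hn : 1 ≤ n) (γi κ : ℝ) (hκ : κ = (n : ℝ) - γi + 1 / (m : ℝ))
    (Q : ℝ≥0∞) (hQ : Q ≠ ∞) (q : ℝ) (hq : q = Q.toReal) (hq0 : 0 < q) (ε θ β : ℝ)
    (hε0 : 0 < ε) (hε : ε < κ) (hθ0 : 0 ≤ θ) (hθ : θ ≤ κ) (hθn : θ < n * q⁻¹)
    (hβ : β = n * q⁻¹ - ε) :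
    ∃ K : ℝ, 0 < K ∧ ∀ (x : Rn n) (R : ℝ), 0 < R →
      HmFactor m γi Q (fun y : Rn n => ENNReal.ofReal (‖y‖ ^ β)) x R ≤
        ENNReal.ofReal (K * ((‖x‖ + R) ^ (ε - θ) * R ^ (θ - κ))) := by
  obtain ⟨c, hc, H⟩ := s13_base hn
  have hβq : β * q = n - ε * q := by rw [hβ]; field_simp
  have hεq : 0 < ε * q := by positivity
  have hεκ : ε * q < κ * q := by gcongr
  obtain ⟨K, hK, HK⟩ := s13_main hn (β * q) (θ * q) (κ * q) (by linarith) (by linarith)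
    (by positivity) (by gcongr) (by
      have := mul_lt_mul_of_pos_right hθn hq0
      rwa [mul_assoc, inv_mul_cancel₀ hq0.ne', mul_one] at this)
  refine ⟨(c ^ (-(κ * q)) * K) ^ (1 / q), by positivity, fun x R hR => ?_⟩
  unfold HmFactor lpOn
  rw [if_neg hQ, ← hκ, ← hq, Measure.restrict_univ]
  have hM : 0 < ‖x‖ + R := by positivity
  have hpt : ∀ᵐ y : Rn n, ((ENNReal.ofReal (‖y‖ ^ β))⁻¹ *
      (volume (ball x R) ^ ((n : ℝ)⁻¹) + edist x y) ^ (-κ)) ^ q ≤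
      ENNReal.ofReal (c ^ (-(κ * q))) *
        ENNReal.ofReal (‖y‖ ^ (-(β * q)) * (R + ‖x - y‖) ^ (-(κ * q))) := by
    filter_upwards [s13_ae_ne hn 0] with y hy
    have hy0 : 0 < ‖y‖ := norm_pos_iff.2 hy
    have hD : 0 < R + ‖x - y‖ := by positivity
    calc _ ≤ (ENNReal.ofReal (‖y‖ ^ (-β)) *
          ENNReal.ofReal (c ^ (-κ) * (R + ‖x - y‖) ^ (-κ))) ^ q := by
          gcongr ?_ ^ q
          · rw [← ENNReal.ofReal_inv_of_pos (by positivity), ← Real.rpow_neg hy0.le]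
            gcongr
            exact H x y R κ hR (by linarith)
      _ = _ := by
          rw [← ENNReal.ofReal_mul (by positivity), ENNReal.ofReal_rpow_of_pos (by positivity),
            ← ENNReal.ofReal_mul (by positivity)]
          congr 1
          rw [Real.mul_rpow (by positivity) (by positivity),
            Real.mul_rpow (by positivity) (by positivity), ← Real.rpow_mul hy0.le,
            ← Real.rpow_mul hc.le, ← Real.rpow_mul hD.le]
          simp only [neg_mul]
          ring
  calc _ ≤ (ENNReal.ofReal (c ^ (-(κ * q))) * ENNReal.ofReal (K *
          ((‖x‖ + R) ^ (n - β * q - θ * q) * R ^ (θ * q - κ * q)))) ^ (1 / q) := by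
        gcongr ?_ ^ (1 / q)
        refine (lintegral_mono_ae hpt).trans ?_
        rw [lintegral_const_mul _ (by fun_prop)]
        gcongr
        exact HK x R hR
    _ = _ := by
        rw [← ENNReal.ofReal_mul (by positivity), ENNReal.ofReal_rpow_of_pos (by positivity)]
        congr 1
        rw [← mul_assoc, Real.mul_rpow (by positivity) (by positivity),
          Real.mul_rpow (Real.rpow_nonneg hM.le _) (Real.rpow_nonneg hR.le _),
          ← Real.rpow_mul hM.le, ← Real.rpow_mul hR.le]
        congr 3
        · rw [hβq]; field_simp; ring
        · field_simp

set_option maxHeartbeats 2000000 in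
theorem statement13 {n m : ℕ} (hn : 1 ≤ n) (hm : 1 ≤ m) (γ δ τ : ℝ) (hγ0 : 0 < γ)
    (hγ : γ < m * n) (p : Fin m → ℝ≥0∞) (hp : ∀ i, 1 ≤ p i)
    (hτ : τ = (γ - m * n) * (1 - 1 / (m : ℝ)) + 1 / (m : ℝ))
    (hδ1 : γ - m * n < δ) (hδ2 : δ < τ)
    (hδ3 : τ ≤ γ - n * ∑ i, ((p i)⁻¹).toReal)
    (ε : ℝ) (hε0 : 0 < ε)
    (hε : ε < (m * n - γ + δ) /
      ((m : ℝ) - (Nat.card {i : Fin m // p i = 1} : ℝ)))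
    (β : Fin m → ℝ)
    (hβ : ∀ i, β i = if p i = 1 then 0 else (n : ℝ) * ((conjE (p i))⁻¹).toReal - ε)
    (α : ℝ) (hα : α = (∑ i, β i) + δ - γ + n * ∑ i, ((p i)⁻¹).toReal) :
    Hm m (fun _ => γ / m) δ p (fun x : Rn n => ENNReal.ofReal (‖x‖ ^ α))
      (fun (i : Fin m) (x : Rn n) => ENNReal.ofReal (‖x‖ ^ β i)) := by
  have hm0 : (0 : ℝ) < m := by positivity
  have hn0 : (0 : ℝ) < n := by positivity
  set d : ℝ := m * n - γ with hd
  have hd0 : 0 < d := by linarith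
  set κ : ℝ := (n : ℝ) - γ / m + 1 / (m : ℝ) with hκ
  have hmκ : m * κ = d + 1 := by rw [hκ, hd]; field_simp
  have hκ0 : 0 < κ := by
    by_contra h
    have : m * κ ≤ 0 := mul_nonpos_of_nonneg_of_nonpos hm0.le (not_lt.1 h)
    linarith
  have hdδ0 : 0 < d + δ := by linarith
  have hdδκ : d + δ < κ := by
    have : τ = κ - d := by rw [hτ, hκ, hd]; field_simp; ring
    linarith
  set N : ℝ := (m : ℝ) - (Nat.card {i : Fin m // p i = 1} : ℝ) with hN
  -- the exponents e_i
  set e : Fin m → ℝ := fun i => if p i = 1 then 0 else ε with he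
  have hsum_e : ∑ i, e i = N * ε := by
    have h1 : ∀ i, e i = ε - if p i = 1 then ε else 0 := fun i => by
      simp only [he]; split_ifs <;> simp
    simp_rw [h1]
    rw [Finset.sum_sub_distrib, ← Finset.sum_filter, Finset.sum_const, Finset.sum_const, hN,
      Nat.card_eq_fintype_card, Fintype.card_subtype]
    simp only [Finset.card_univ, Fintype.card_fin, nsmul_eq_mul]
    ring
  have hN1 : 0 < N := by
    by_contra h
    have : (m * n - γ + δ) / N ≤ 0 := div_nonpos_of_nonneg_of_nonpos hdδ0.le (not_lt.1 h)
    linarith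
  have hN2 : 1 ≤ N := by
    have h1 : Nat.card {i : Fin m // p i = 1} < m := by
      have : ((Nat.card {i : Fin m // p i = 1} : ℕ) : ℝ) < m := by linarith
      exact_mod_cast this
    have h2 : ((Nat.card {i : Fin m // p i = 1} : ℕ) : ℝ) + 1 ≤ m := by exact_mod_cast h1
    linarith
  have hNε : N * ε < d + δ := by rw [lt_div_iff₀ hN1] at hε; linarith
  have hεκ : ε < κ := by nlinarith
  have hβ' : ∀ i, β i = n * (1 - ((p i)⁻¹).toReal) - e i := fun i => by
    rw [hβ i]; simp only [he]
    split_ifs with h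
    · simp [h]
    · rw [s13_conj_inv _ (hp i)]
  have hαe : α = d + δ - N * ε := by
    rw [hα, Finset.sum_congr rfl (fun i _ => hβ' i), Finset.sum_sub_distrib, hsum_e,
      ← Finset.mul_sum, Finset.sum_sub_distrib]
    simp only [Finset.sum_const, Finset.card_univ, Fintype.card_fin, nsmul_eq_mul]
    rw [hd]; ring
  have hα0 : 0 < α := by linarith
  -- the exponents θ_i
  set r : Fin m → ℝ := fun i => 1 - ((p i)⁻¹).toReal with hr
  have hr0 : ∀ i, 0 ≤ r i := fun i => by
    simp only [hr]
    rw [← s13_conj_inv _ (hp i)]; exact ENNReal.toReal_nonneg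
  set s : Fin m → ℝ := fun i => min κ (n * r i) with hs
  have hs0 : ∀ i, 0 ≤ s i := fun i => le_min hκ0.le (mul_nonneg hn0.le (hr0 i))
  have hS : d + δ < ∑ i, s i := by
    by_cases h : ∃ i, κ ≤ n * r i
    · obtain ⟨i, hi⟩ := h
      have h1 : s i = κ := min_eq_left hi
      have h2 : s i ≤ ∑ i, s i :=
        Finset.single_le_sum (f := s) (fun j _ => hs0 j) (Finset.mem_univ i)
      linarith
    · push Not at h
      have h1 : ∑ i, s i = ∑ i, n * r i :=
        Finset.sum_congr rfl fun i _ => min_eq_right (h i).le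
      rw [h1, ← Finset.mul_sum]
      simp only [hr]
      rw [Finset.sum_sub_distrib]
      simp only [Finset.sum_const, Finset.card_univ, Fintype.card_fin, nsmul_eq_mul]
      rw [hd]
      linarith
  set S := ∑ i, s i with hSdef
  have hS0 : 0 < S := by linarith
  set t := (d + δ) / S with ht
  have ht0 : 0 < t := by positivity
  have ht1 : t < 1 := by rw [ht, div_lt_one hS0]; exact hS
  have hsum_θ : ∑ i, t * s i = d + δ := by
    rw [← Finset.mul_sum, ← hSdef, ht]; field_simp
  -- factor bounds
  have hfac : ∀ i, ∃ K : ℝ, 0 < K ∧ ∀ (x : Rn n) (R : ℝ), 0 < R →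
      HmFactor m (γ / m) (conjE (p i)) (fun y : Rn n => ENNReal.ofReal (‖y‖ ^ β i)) x R ≤
        ENNReal.ofReal (K * ((‖x‖ + R) ^ (e i - t * s i) * R ^ (t * s i - κ))) := fun i => by
    by_cases hi : p i = 1
    · have h1 : β i = 0 := by rw [hβ i, if_pos hi]
      have h2 : s i = 0 := by simp [hs, hr, hi, hκ0.le]
      have h3 : e i = 0 := by simp [he, hi]
      have h4 : conjE (p i) = ∞ := by simp [conjE, hi]
      obtain ⟨K, hK, H⟩ := s13_factor_top (m := m) hn (γ / m) κ hκ hκ0.le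
      refine ⟨K, hK, fun x R hR => ?_⟩
      rw [h1, h2, h3, h4]
      simpa using H x R hR
    · have hq0 := s13_conj_pos (p i) (hp i) hi
      have hrq : ((conjE (p i)).toReal)⁻¹ = r i := by
        rw [← ENNReal.toReal_inv, s13_conj_inv _ (hp i)]
      have hri : 0 < r i := by rw [← hrq]; positivity
      have hsi : 0 < s i := lt_min hκ0 (by positivity)
      have h1 : t * s i < s i := by nlinarith
      have h3 : e i = ε := by simp [he, hi]
      rw [h3]
      exact s13_factor hn (γ / m) κ hκ _ (s13_conj_ne_top _ hi) _ rfl hq0 ε (t * s i) (β i)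
        hε0 hεκ (by positivity) (h1.le.trans (min_le_left _ _))
        (by rw [hrq]; exact h1.trans_le (min_le_right _ _))
        (by rw [hrq, hβ' i, h3])
  choose K hK HK using hfac
  obtain ⟨c, hc, Hc⟩ := s13_vol hn
  refine ⟨c ^ (1 - δ) * ∏ i, K i, mul_pos (by positivity) (Finset.prod_pos fun i _ => hK i),
    fun x R hR => ?_⟩
  have hM : 0 < ‖x‖ + R := by positivity
  have hw : essSup (fun x : Rn n => ENNReal.ofReal (‖x‖ ^ α)) (volume.restrict (ball x R)) ≤
      ENNReal.ofReal ((‖x‖ + R) ^ α) := by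
    refine essSup_le_of_ae_le _ ?_
    filter_upwards [ae_restrict_mem measurableSet_ball] with y hy
    apply ENNReal.ofReal_le_ofReal
    apply Real.rpow_le_rpow (norm_nonneg _) _ hα0.le
    rw [mem_ball, dist_eq_norm] at hy
    have : ‖y‖ ≤ ‖y - x‖ + ‖x‖ := by simpa using norm_add_le (y - x) x
    linarith
  have hexp : (n : ℝ) * (-((δ - 1) / n)) = 1 - δ := by field_simp; ring
  calc _ ≤ ENNReal.ofReal ((‖x‖ + R) ^ α) * ENNReal.ofReal ((c * R) ^ (1 - δ)) *
        ∏ i, ENNReal.ofReal (K i * ((‖x‖ + R) ^ (e i - t * s i) * R ^ (t * s i - κ))) := by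
        rw [Hc x R _ hR, hexp]
        gcongr with i
        exact HK i x R hR
    _ = _ := by
        rw [← ENNReal.ofReal_prod_of_nonneg (fun i _ => by have := hK i; positivity),
          ← ENNReal.ofReal_mul (by positivity), ← ENNReal.ofReal_mul (by positivity)]
        congr 1
        rw [Finset.prod_mul_distrib, Finset.prod_mul_distrib, ← Real.rpow_sum_of_pos hM,
          ← Real.rpow_sum_of_pos hR, Finset.sum_sub_distrib, Finset.sum_sub_distrib, hsum_θ, hsum_e,
          Real.mul_rpow hc.le hR.le]
        simp only [Finset.sum_const, Finset.card_univ, Fintype.card_fin, nsmul_eq_mul]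
        have x1 : (‖x‖ + R) ^ α * (‖x‖ + R) ^ (N * ε - (d + δ)) = 1 := by
          rw [← Real.rpow_add hM, hαe]
          ring_nf
          simp
        have x2 : R ^ (1 - δ) * R ^ (d + δ - m * κ) = 1 := by
          rw [← Real.rpow_add hR, hmκ]
          ring_nf
          simp
        calc _ = c ^ (1 - δ) * (∏ i, K i) *
              ((‖x‖ + R) ^ α * (‖x‖ + R) ^ (N * ε - (d + δ))) *
              (R ^ (1 - δ) * R ^ (d + δ - m * κ)) := by ring
          _ = _ := by rw [x1, x2]; ring
end
end

section
/- Let 0 < γ < mn, take γ_i = γ/m for every i, let p⃗ be a vector of exponents, and set τ = (γ-mn)(1-1/m)+1/m. Suppose γ - mn < δ ≤ γ - n/p < τ. Define β_i = (γ-δ)/m - n/p_i for every 1 ≤ i ≤ m. Then the pair (w,v⃗) with w ≡ 1 and v_i(x) = |x|^{β_i} belongs to ℍ_m(p⃗,γ,δ). -/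
open MeasureTheory Metric Set
open scoped ENNReal NNReal BigOperators Classical

noncomputable section

theorem aux_int {n : ℕ} (hn : 1 ≤ n) {b A : ℝ} (hb0 : 0 ≤ b) (hb : b < n) (hA : (n : ℝ) < A) :
    Integrable (fun y : Rn n => ‖y‖ ^ (-b) * (1 + ‖y‖) ^ (b - A)) := by
  have hm : AEStronglyMeasurable (fun y : Rn n => ‖y‖ ^ (-b) * (1 + ‖y‖) ^ (b - A)) volume :=
    Measurable.aestronglyMeasurable (by fun_prop)
  rw [← integrableOn_univ, ← union_compl_self (ball (0 : Rn n) 1)]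
  apply IntegrableOn.union
  · refine integrableOn_ball_of_norm_le_rpow (C := 1) (α := b) (by simpa using hn)
      (by simpa using hb) (Filter.Eventually.of_forall fun y => ?_) hm
    have h0 : 0 ≤ ‖y‖ := norm_nonneg y
    rw [Real.norm_of_nonneg (by positivity), one_mul]
    have : (1 + ‖y‖) ^ (b - A) ≤ 1 :=
      Real.rpow_le_one_of_one_le_of_nonpos (by linarith) (by linarith)
    have h2 : 0 ≤ ‖y‖ ^ (-b) := by positivity
    nlinarith
  · have h1 : Integrable (fun y : Rn n => (2 : ℝ) ^ b * (1 + ‖y‖) ^ (-A)) :=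
      (integrable_one_add_norm (by simpa using hA)).const_mul _
    refine Integrable.mono' h1.integrableOn hm.restrict ?_
    refine (ae_restrict_iff' measurableSet_ball.compl).2 (Filter.Eventually.of_forall fun y hy => ?_)
    have h0 : 1 ≤ ‖y‖ := by simpa using hy
    rw [Real.norm_of_nonneg (by positivity)]
    have h3 : ‖y‖ ^ (-b) ≤ ((1 + ‖y‖) / 2) ^ (-b) :=
      Real.rpow_le_rpow_of_nonpos (by positivity) (by linarith) (by linarith)
    have h4 : ((1 + ‖y‖) / 2) ^ (-b) = 2 ^ b * (1 + ‖y‖) ^ (-b) := by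
      rw [Real.div_rpow (by positivity) (by positivity), Real.rpow_neg (by norm_num : (0:ℝ) ≤ 2)]
      field_simp
    calc _ ≤ (2 ^ b * (1 + ‖y‖) ^ (-b)) * (1 + ‖y‖) ^ (b - A) := by
          rw [← h4]; gcongr
      _ = _ := by rw [mul_assoc, ← Real.rpow_add (by positivity)]; ring_nf

theorem aux_K1 {n : ℕ} (hn : 1 ≤ n) {b A : ℝ} (hb : b < n) (hA : (n : ℝ) < A)
    (hAb : (n : ℝ) < A + b) : ∃ C : ℝ, 0 < C ∧ ∀ x : Rn n,
      ∫⁻ y : Rn n, ENNReal.ofReal (‖y‖ ^ (-b) * (1 + ‖x - y‖) ^ (-A)) ≤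
        ENNReal.ofReal (C * (1 + ‖x‖) ^ (-b)) := by
  have hn0 : (0 : ℝ) ≤ n := by positivity
  rcases lt_or_ge b 0 with hb0 | hb0
  · have hI : Integrable (fun y : Rn n => (1 + ‖y‖) ^ (-(A + b))) :=
      integrable_one_add_norm (by simpa using hAb)
    have hlt := hI.lintegral_lt_top
    set I := ∫⁻ y : Rn n, ENNReal.ofReal ((1 + ‖y‖) ^ (-(A + b))) with hIdef
    refine ⟨I.toReal + 1, by positivity, fun x => ?_⟩
    calc _ ≤ ∫⁻ y : Rn n, ENNReal.ofReal ((1 + ‖x‖) ^ (-b)) *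
            ENNReal.ofReal ((1 + ‖x - y‖) ^ (-(A + b))) := by
          refine lintegral_mono fun y => ?_
          rw [← ENNReal.ofReal_mul (by positivity)]
          refine ENNReal.ofReal_le_ofReal ?_
          have hy : ‖y‖ ≤ (1 + ‖x‖) * (1 + ‖x - y‖) := by
            have := norm_sub_norm_le y x
            rw [norm_sub_rev] at this
            nlinarith [norm_nonneg x, norm_nonneg (x - y)]
          calc _ ≤ ((1 + ‖x‖) * (1 + ‖x - y‖)) ^ (-b) * (1 + ‖x - y‖) ^ (-A) := by
                gcongr
                linarith
            _ = _ := by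
                rw [Real.mul_rpow (by positivity) (by positivity), mul_assoc,
                  ← Real.rpow_add (by positivity)]
                ring_nf
      _ = ENNReal.ofReal ((1 + ‖x‖) ^ (-b)) * I := by
          rw [lintegral_const_mul' _ _ ENNReal.ofReal_ne_top, hIdef,
            lintegral_sub_left_eq_self (fun y : Rn n => ENNReal.ofReal ((1 + ‖y‖) ^ (-(A + b)))) x]
      _ ≤ _ := by
          rw [mul_comm (I.toReal + 1), ENNReal.ofReal_mul (by positivity)]
          gcongr
          rw [← ENNReal.ofReal_toReal hlt.ne]
          exact ENNReal.ofReal_le_ofReal (by simp)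
  · have hI : Integrable (fun y : Rn n => (1 + ‖y‖) ^ (-A)) :=
      integrable_one_add_norm (by simpa using hA)
    have hlt := hI.lintegral_lt_top
    have hlt2 := (aux_int hn hb0 hb hA).lintegral_lt_top
    set I := ∫⁻ y : Rn n, ENNReal.ofReal ((1 + ‖y‖) ^ (-A)) with hIdef
    set J := ∫⁻ y : Rn n, ENNReal.ofReal (‖y‖ ^ (-b) * (1 + ‖y‖) ^ (b - A)) with hJdef
    have hIJ : I + J < ∞ := ENNReal.add_lt_top.2 ⟨hlt, hlt2⟩
    refine ⟨2 ^ A * ((I + J).toReal + 1), by positivity, fun x => ?_⟩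
    calc _ ≤ ∫⁻ y : Rn n, ENNReal.ofReal (2 ^ A * (1 + ‖x‖) ^ (-b)) *
            (ENNReal.ofReal ((1 + ‖x - y‖) ^ (-A)) +
              ENNReal.ofReal (‖y‖ ^ (-b) * (1 + ‖y‖) ^ (b - A))) := by
          refine lintegral_mono fun y => ?_
          rw [← ENNReal.ofReal_add (by positivity) (by positivity),
            ← ENNReal.ofReal_mul (by positivity)]
          refine ENNReal.ofReal_le_ofReal ?_
          have ht : ‖x‖ ≤ ‖x - y‖ + ‖y‖ := by
            simpa using norm_add_le (x - y) y
          have hx0 := norm_nonneg x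
          have hy0 := norm_nonneg y
          have hxy0 := norm_nonneg (x - y)
          rcases le_or_gt (1 + ‖x - y‖) ‖y‖ with h | h
          · have h1 : ‖y‖ ^ (-b) ≤ 2 ^ A * (1 + ‖x‖) ^ (-b) := by
              calc ‖y‖ ^ (-b) ≤ ((1 + ‖x‖) / 2) ^ (-b) :=
                    Real.rpow_le_rpow_of_nonpos (by positivity) (by linarith) (by linarith)
                _ = 2 ^ b * (1 + ‖x‖) ^ (-b) := by
                    rw [Real.div_rpow (by positivity) (by positivity),
                      Real.rpow_neg (by norm_num : (0:ℝ) ≤ 2)]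
                    field_simp
                _ ≤ _ := by
                    gcongr
                    · norm_num
                    · linarith
            calc _ ≤ (2 ^ A * (1 + ‖x‖) ^ (-b)) * (1 + ‖x - y‖) ^ (-A) := by gcongr
              _ ≤ _ := by
                gcongr
                exact le_add_of_nonneg_right (by positivity)
          · have h1 : (1 + ‖x - y‖) ^ (-b) ≤ 2 ^ b * (1 + ‖x‖) ^ (-b) := by
              calc _ ≤ ((1 + ‖x‖) / 2) ^ (-b) :=
                    Real.rpow_le_rpow_of_nonpos (by positivity) (by linarith) (by linarith)
                _ = 2 ^ b * (1 + ‖x‖) ^ (-b) := by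
                    rw [Real.div_rpow (by positivity) (by positivity),
                      Real.rpow_neg (by norm_num : (0:ℝ) ≤ 2)]
                    field_simp
            have h2 : (1 + ‖x - y‖) ^ (b - A) ≤ 2 ^ (A - b) * (1 + ‖y‖) ^ (b - A) := by
              calc _ ≤ ((1 + ‖y‖) / 2) ^ (b - A) :=
                    Real.rpow_le_rpow_of_nonpos (by positivity) (by linarith) (by linarith)
                _ = _ := by
                    rw [Real.div_rpow (by positivity) (by positivity), ← neg_sub A b,
                      Real.rpow_neg (by norm_num : (0:ℝ) ≤ 2)]
                    field_simp
            calc _ = ‖y‖ ^ (-b) * ((1 + ‖x - y‖) ^ (-b) * (1 + ‖x - y‖) ^ (b - A)) := by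
                  rw [← Real.rpow_add (by positivity)]; ring_nf
              _ ≤ ‖y‖ ^ (-b) * ((2 ^ b * (1 + ‖x‖) ^ (-b)) *
                    (2 ^ (A - b) * (1 + ‖y‖) ^ (b - A))) := by gcongr
              _ = ((2 ^ b * 2 ^ (A - b)) * (1 + ‖x‖) ^ (-b)) *
                    (‖y‖ ^ (-b) * (1 + ‖y‖) ^ (b - A)) := by ring
              _ = (2 ^ A * (1 + ‖x‖) ^ (-b)) *
                    (‖y‖ ^ (-b) * (1 + ‖y‖) ^ (b - A)) := by
                  rw [← Real.rpow_add (by norm_num)]; ring_nf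
              _ ≤ _ := by
                gcongr
                exact le_add_of_nonneg_left (by positivity)
      _ = ENNReal.ofReal (2 ^ A * (1 + ‖x‖) ^ (-b)) * (I + J) := by
          rw [lintegral_const_mul' _ _ ENNReal.ofReal_ne_top,
            lintegral_add_right _ (by fun_prop), hIdef,
            lintegral_sub_left_eq_self (fun y : Rn n => ENNReal.ofReal ((1 + ‖y‖) ^ (-A))) x]
      _ ≤ _ := by
          rw [mul_right_comm,
            ENNReal.ofReal_mul (q := (I + J).toReal + 1) (by positivity)]
          gcongr
          rw [← ENNReal.ofReal_toReal hIJ.ne]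
          exact ENNReal.ofReal_le_ofReal (by simp)

theorem aux_scale {n : ℕ} (f : Rn n → ℝ≥0∞) (hf : Measurable f) {ρ : ℝ} (hρ : 0 < ρ) :
    ∫⁻ y, f y = ENNReal.ofReal (ρ ^ n) * ∫⁻ y, f (ρ • y) := by
  have h := Measure.map_addHaar_smul (volume : Measure (Rn n)) hρ.ne'
  have h2 : ∫⁻ y, f (ρ • y) = ∫⁻ y, f y ∂(Measure.map (ρ • ·) (volume : Measure (Rn n))) :=
    (lintegral_map hf (by fun_prop)).symm
  rw [h2, h, lintegral_smul_measure, smul_eq_mul, ← mul_assoc,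
    ← ENNReal.ofReal_mul (by positivity), abs_of_pos (by positivity)]
  simp [hρ.ne']

theorem aux_K {n : ℕ} (hn : 1 ≤ n) {b A : ℝ} (hb : b < n) (hA : (n : ℝ) < A)
    (hAb : (n : ℝ) < A + b) : ∃ C : ℝ, 0 < C ∧ ∀ (x : Rn n) (ρ : ℝ), 0 < ρ →
      ∫⁻ y : Rn n, ENNReal.ofReal (‖y‖ ^ (-b) * (ρ + ‖x - y‖) ^ (-A)) ≤
        ENNReal.ofReal (C * (ρ ^ ((n : ℝ) - A) * (ρ + ‖x‖) ^ (-b))) := by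
  obtain ⟨C, hC, h⟩ := aux_K1 hn hb hA hAb
  refine ⟨C, hC, fun x ρ hρ => ?_⟩
  rw [aux_scale _ (by fun_prop) hρ]
  have e1 : ∀ z : Rn n, ρ + ‖x - ρ • z‖ = ρ * (1 + ‖ρ⁻¹ • x - z‖) := by
    intro z
    have : x - ρ • z = ρ • (ρ⁻¹ • x - z) := by
      rw [smul_sub, smul_smul, mul_inv_cancel₀ hρ.ne', one_smul]
    rw [this, norm_smul, Real.norm_of_nonneg hρ.le]; ring
  have e2 : ρ + ‖x‖ = ρ * (1 + ‖ρ⁻¹ • x‖) := by simpa using e1 0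
  have e3 : ∀ y : Rn n, ENNReal.ofReal (‖ρ • y‖ ^ (-b) * (ρ + ‖x - ρ • y‖) ^ (-A)) =
      ENNReal.ofReal (ρ ^ (-b) * ρ ^ (-A)) *
        ENNReal.ofReal (‖y‖ ^ (-b) * (1 + ‖ρ⁻¹ • x - y‖) ^ (-A)) := by
    intro y
    rw [e1, ← ENNReal.ofReal_mul (by positivity), norm_smul, Real.norm_of_nonneg hρ.le,
      Real.mul_rpow hρ.le (by positivity), Real.mul_rpow hρ.le (by positivity)]
    ring_nf
  simp_rw [e3]
  rw [lintegral_const_mul' _ _ ENNReal.ofReal_ne_top]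
  calc _ ≤ ENNReal.ofReal (ρ ^ n) * (ENNReal.ofReal (ρ ^ (-b) * ρ ^ (-A)) *
        ENNReal.ofReal (C * (1 + ‖ρ⁻¹ • x‖) ^ (-b))) := by gcongr; exact h _
    _ = _ := by
      rw [← ENNReal.ofReal_mul (by positivity), ← ENNReal.ofReal_mul (by positivity), e2,
        Real.mul_rpow hρ.le (by positivity), sub_eq_add_neg, Real.rpow_add hρ, Real.rpow_natCast]
      ring_nf

theorem aux_pt {n : ℕ} {β a ρ : ℝ} (hρ : 0 < ρ) (x y : Rn n) (hy : y ≠ 0) :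
    (ENNReal.ofReal (‖y‖ ^ β))⁻¹ * (ENNReal.ofReal ρ + edist x y) ^ (-a) =
      ENNReal.ofReal (‖y‖ ^ (-β) * (ρ + ‖x - y‖) ^ (-a)) := by
  have h0 : 0 < ‖y‖ := norm_pos_iff.2 hy
  rw [edist_dist, dist_eq_norm, ← ENNReal.ofReal_add hρ.le (norm_nonneg _),
    ENNReal.ofReal_rpow_of_pos (by positivity), ← ENNReal.ofReal_inv_of_pos (by positivity),
    ← ENNReal.ofReal_mul (by positivity), Real.rpow_neg h0.le]

/-- The bound for a single factor. -/
theorem aux_factor {n m : ℕ} (hn : 1 ≤ n) (P : ℝ≥0∞) (hP : 1 ≤ P) {γi β : ℝ}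
    (h1 : β < n - n * (P⁻¹).toReal ∨ P = 1 ∧ β ≤ 0)
    (h2 : n - n * (P⁻¹).toReal < n - γi + 1 / (m : ℝ))
    (h3 : n - n * (P⁻¹).toReal < n - γi + 1 / (m : ℝ) + β) :
    ∃ C : ℝ, 0 < C ∧ ∀ (x : Rn n) (R ρ : ℝ), 0 < ρ →
      volume (ball x R) ^ ((n : ℝ)⁻¹) = ENNReal.ofReal ρ →
      HmFactor m γi (conjE P) (fun y : Rn n => ENNReal.ofReal (‖y‖ ^ β)) x R ≤
        ENNReal.ofReal (C * (ρ ^ (n - n * (P⁻¹).toReal - (n - γi + 1 / (m : ℝ))) *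
          (ρ + ‖x‖) ^ (-β))) := by
  have : Nonempty (Fin n) := ⟨⟨0, hn⟩⟩
  have hnt : Nontrivial (Rn n) := inferInstance
  have hae : ∀ᵐ y : Rn n, y ≠ 0 := by
    simp [ae_iff]
  set a := (n : ℝ) - γi + 1 / (m : ℝ) with ha
  by_cases hP1 : P = 1
  · subst hP1
    have hβ : β ≤ 0 := by
      rcases h1 with h1 | h1
      · simp at h1; exact h1.le
      · exact h1.2
    simp at h2 h3
    refine ⟨1, one_pos, fun x R ρ hρ hv => ?_⟩
    have : conjE 1 = ∞ := by simp [conjE]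
    rw [HmFactor, this, lpOn, if_pos rfl, Measure.restrict_univ]
    refine essSup_le_of_ae_le _ ?_
    filter_upwards [hae] with y hy
    rw [hv, aux_pt hρ x y hy]
    refine ENNReal.ofReal_le_ofReal ?_
    have hyx : ‖y‖ ≤ (ρ + ‖x‖) * ((ρ + ‖x - y‖) / ρ) := by
      have := norm_sub_norm_le y x
      rw [norm_sub_rev] at this
      rw [← mul_div_assoc, le_div_iff₀ hρ]
      nlinarith [norm_nonneg x, norm_nonneg (x - y), mul_nonneg (norm_nonneg x) (norm_nonneg (x - y))]
    have hx0 := norm_nonneg x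
    have hxy0 := norm_nonneg (x - y)
    calc _ ≤ ((ρ + ‖x‖) * ((ρ + ‖x - y‖) / ρ)) ^ (-β) * (ρ + ‖x - y‖) ^ (-a) := by
          gcongr
          linarith
      _ = (ρ + ‖x‖) ^ (-β) * ρ ^ β * (ρ + ‖x - y‖) ^ (-(a + β)) := by
          rw [Real.mul_rpow (by positivity) (by positivity),
            Real.div_rpow (by positivity) (by positivity),
            show -(a + β) = -β + -a by ring, Real.rpow_add (by positivity),
            Real.rpow_neg hρ.le]
          field_simp
      _ ≤ (ρ + ‖x‖) ^ (-β) * ρ ^ β * ρ ^ (-(a + β)) := by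
          gcongr ?_ * ?_
          exact Real.rpow_le_rpow_of_nonpos hρ (by linarith) (by linarith)
      _ = _ := by
          rw [mul_assoc, ← Real.rpow_add hρ]
          simp
          ring_nf
  · have h1' : β < n - n * (P⁻¹).toReal := by
      rcases h1 with h1 | h1
      · exact h1
      · exact absurd h1.1 hP1
    obtain ⟨q, hq0, hqE, hqc⟩ : ∃ q : ℝ, 0 < q ∧ conjE P = ENNReal.ofReal q ∧
        1 - (P⁻¹).toReal = 1 / q := by
      by_cases hPt : P = ∞
      · exact ⟨1, one_pos, by simp [conjE, hPt], by simp [hPt]⟩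
      · have : 1 < P.toReal := by
          rw [← ENNReal.toReal_one]
          exact (ENNReal.toReal_lt_toReal ENNReal.one_ne_top hPt).2 (lt_of_le_of_ne hP (Ne.symm hP1))
        refine ⟨P.toReal / (P.toReal - 1), div_pos (by linarith) (by linarith),
          by simp [conjE, hPt, hP1], ?_⟩
        have h5 : P.toReal - 1 ≠ 0 := by linarith
        rw [ENNReal.toReal_inv]
        field_simp
    have hN : (n : ℝ) - n * (P⁻¹).toReal = n / q := by
      rw [← mul_one_sub, hqc]; ring
    rw [hN] at h1' h2 h3 ⊢
    rw [lt_div_iff₀ hq0] at h1'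
    rw [div_lt_iff₀ hq0] at h2 h3
    obtain ⟨C, hC, h⟩ := aux_K hn (b := β * q) (A := a * q) h1' h2 (by linarith)
    refine ⟨C ^ (1 / q), by positivity, fun x R ρ hρ hv => ?_⟩
    have hx0 := norm_nonneg x
    rw [HmFactor, hqE, lpOn, if_neg ENNReal.ofReal_ne_top, Measure.restrict_univ,
      ENNReal.toReal_ofReal hq0.le, hv]
    have e : ∫⁻ y : Rn n, ((ENNReal.ofReal (‖y‖ ^ β))⁻¹ *
          (ENNReal.ofReal ρ + edist x y) ^ (-a)) ^ q =
        ∫⁻ y : Rn n, ENNReal.ofReal (‖y‖ ^ (-(β * q)) * (ρ + ‖x - y‖) ^ (-(a * q))) := by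
      refine lintegral_congr_ae ?_
      filter_upwards [hae] with y hy
      have h0 : 0 < ‖y‖ := norm_pos_iff.2 hy
      have hxy0 := norm_nonneg (x - y)
      rw [aux_pt hρ x y hy, ENNReal.ofReal_rpow_of_pos (by positivity),
        Real.mul_rpow (by positivity) (by positivity), ← Real.rpow_mul (by positivity),
        ← Real.rpow_mul (by positivity), neg_mul, neg_mul]
    rw [e]
    calc _ ≤ (ENNReal.ofReal (C * (ρ ^ ((n : ℝ) - a * q) * (ρ + ‖x‖) ^ (-(β * q))))) ^ (1 / q) := by
          gcongr
          exact h x ρ hρ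
      _ = _ := by
          rw [ENNReal.ofReal_rpow_of_pos (by positivity), Real.mul_rpow hC.le (by positivity),
            Real.mul_rpow (by positivity) (by positivity), ← Real.rpow_mul hρ.le,
            ← Real.rpow_mul (by positivity)]
          congr 4
          · congr 1; field_simp
          · field_simp

/-- power-weight examples in the region
`γ - mn < δ ≤ γ - n/p < τ`, with `w ≡ 1`. -/
theorem statement14 {n m : ℕ} (hn : 1 ≤ n) (hm : 1 ≤ m) (γ δ τ : ℝ) (hγ0 : 0 < γ)
    (hγ : γ < m * n) (p : Fin m → ℝ≥0∞) (hp : ∀ i, 1 ≤ p i)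
    (hτ : τ = (γ - m * n) * (1 - 1 / (m : ℝ)) + 1 / (m : ℝ))
    (hδ1 : γ - m * n < δ) (hδ2 : δ ≤ γ - n * ∑ i, ((p i)⁻¹).toReal)
    (hδ3 : γ - n * ∑ i, ((p i)⁻¹).toReal < τ)
    (β : Fin m → ℝ)
    (hβ : ∀ i, β i = (γ - δ) / m - (n : ℝ) * ((p i)⁻¹).toReal) :
    Hm m (fun _ => γ / m) δ p (fun _ : Rn n => (1 : ℝ≥0∞))
      (fun (i : Fin m) (x : Rn n) => ENNReal.ofReal (‖x‖ ^ β i)) := by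
  have hm0 : (0 : ℝ) < m := by exact_mod_cast hm
  have hm1 : (1 : ℝ) ≤ m := by exact_mod_cast hm
  have hn0 : (0 : ℝ) < n := by exact_mod_cast hn
  have hpi : ∀ i, ((p i)⁻¹).toReal ≤ 1 := fun i => by
    have : (p i)⁻¹ ≤ 1 := ENNReal.inv_le_one.2 (hp i)
    simpa using ENNReal.toReal_mono ENNReal.one_ne_top this
  have hτ' : τ = γ - ((γ - 1) / m + n * (m - 1)) := by
    rw [hτ]; field_simp; ring
  have hinv : 1 / (m : ℝ) ≤ 1 := by rw [div_le_one hm0]; exact hm1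
  have hδlt : δ < 1 := by
    have h1 : τ ≤ 1 := by
      rw [hτ]
      nlinarith
    linarith
  have hpi2 : ∀ i, (γ - 1) / m < n * ((p i)⁻¹).toReal := fun i => by
    have h1 : ∑ j, ((p j)⁻¹).toReal ≤ ((p i)⁻¹).toReal + (m - 1) := by
      rw [← Finset.add_sum_erase _ _ (Finset.mem_univ i)]
      gcongr
      calc _ ≤ ∑ j ∈ Finset.univ.erase i, (1 : ℝ) := Finset.sum_le_sum fun j _ => hpi j
        _ = _ := by
          rw [Finset.sum_const, Finset.card_erase_of_mem (Finset.mem_univ i)]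
          simp [Nat.cast_sub hm]
    have h2 := mul_le_mul_of_nonneg_left h1 hn0.le
    linarith
  have hfac : ∀ i, ∃ C : ℝ, 0 < C ∧ ∀ (x : Rn n) (R ρ : ℝ), 0 < ρ →
      volume (ball x R) ^ ((n : ℝ)⁻¹) = ENNReal.ofReal ρ →
      HmFactor m (γ / m) (conjE (p i)) (fun y : Rn n => ENNReal.ofReal (‖y‖ ^ β i)) x R ≤
        ENNReal.ofReal (C * (ρ ^ (n - n * ((p i)⁻¹).toReal - (n - γ / m + 1 / (m : ℝ))) *
          (ρ + ‖x‖) ^ (-β i))) := by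
    intro i
    have hk : (γ - δ) / m < n := by rw [div_lt_iff₀ hm0]; linarith
    have hk2 : 0 < (1 - δ) / m := div_pos (by linarith) hm0
    have := hpi2 i
    refine aux_factor hn (p i) (hp i) (Or.inl ?_) ?_ ?_
    · rw [hβ]; linarith
    · rw [sub_div] at this; linarith
    · rw [hβ]; rw [sub_div] at hk2 ⊢; linarith
  choose C hC hfac using hfac
  refine ⟨∏ i, C i, Finset.prod_pos fun i _ => hC i, fun x R hR => ?_⟩
  have hVpos : 0 < volume (ball x R) := measure_ball_pos _ _ hR
  have hVfin : volume (ball x R) ≠ ∞ := measure_ball_lt_top.ne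
  obtain ⟨V, hV, hVe⟩ : ∃ V : ℝ, 0 < V ∧ volume (ball x R) = ENNReal.ofReal V :=
    ⟨_, ENNReal.toReal_pos hVpos.ne' hVfin, (ENNReal.ofReal_toReal hVfin).symm⟩
  set ρ := V ^ ((n : ℝ)⁻¹) with hρdef
  have hρ : 0 < ρ := by positivity
  have hρe : volume (ball x R) ^ ((n : ℝ)⁻¹) = ENNReal.ofReal ρ := by
    rw [hVe, ENNReal.ofReal_rpow_of_pos hV]
  have hw : essSup (fun _ : Rn n => (1 : ℝ≥0∞)) (volume.restrict (ball x R)) ≤ 1 :=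
    essSup_le_of_ae_le _ (Filter.Eventually.of_forall fun _ => le_rfl)
  have hVp : volume (ball x R) ^ (-((δ - 1) / (n : ℝ))) = ENNReal.ofReal (ρ ^ (1 - δ)) := by
    rw [hVe, ENNReal.ofReal_rpow_of_pos hV, hρdef, ← Real.rpow_mul hV.le]
    congr 2
    field_simp
    ring
  have hx0 := norm_nonneg x
  have hsβ : ∑ i, β i = γ - δ - n * ∑ i, ((p i)⁻¹).toReal := by
    simp_rw [hβ]
    rw [Finset.sum_sub_distrib, ← Finset.mul_sum]
    simp
    field_simp
  have hse : ∑ i, ((n : ℝ) - n * ((p i)⁻¹).toReal - (n - γ / m + 1 / (m : ℝ))) =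
      γ - 1 - n * ∑ i, ((p i)⁻¹).toReal := by
    rw [Finset.sum_sub_distrib, Finset.sum_sub_distrib, ← Finset.mul_sum]
    simp
    field_simp
    ring
  calc _ ≤ 1 * ENNReal.ofReal (ρ ^ (1 - δ)) *
        ∏ i, ENNReal.ofReal (C i * (ρ ^ (n - n * ((p i)⁻¹).toReal - (n - γ / m + 1 / (m : ℝ))) *
          (ρ + ‖x‖) ^ (-β i))) := by
        rw [hVp]
        gcongr with i
        exact hfac i x R ρ hρ hρe
    _ = ENNReal.ofReal ((∏ i, C i) * (ρ ^ (1 - δ) * (ρ ^ (γ - 1 - n * ∑ i, ((p i)⁻¹).toReal) *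
          (ρ + ‖x‖) ^ (-∑ i, β i)))) := by
        rw [one_mul, ← ENNReal.ofReal_prod_of_nonneg
          (fun i _ => by have := hC i; positivity), ← ENNReal.ofReal_mul (by positivity),
          Finset.prod_mul_distrib, Finset.prod_mul_distrib, ← Real.rpow_sum_of_pos hρ,
          ← Real.rpow_sum_of_pos (by positivity), hse, Finset.sum_neg_distrib]
        congr 1
        ring
    _ ≤ ENNReal.ofReal ((∏ i, C i) * 1) := by
        refine ENNReal.ofReal_le_ofReal
          (mul_le_mul_of_nonneg_left ?_ (Finset.prod_nonneg fun i _ => (hC i).le))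
        calc _ ≤ ρ ^ (1 - δ) * (ρ ^ (γ - 1 - n * ∑ i, ((p i)⁻¹).toReal) *
              ρ ^ (-∑ i, β i)) := by
              gcongr ?_ * (?_ * ?_)
              exact Real.rpow_le_rpow_of_nonpos hρ (by linarith) (by linarith)
          _ = 1 := by
              rw [← Real.rpow_add hρ, ← Real.rpow_add hρ, hsβ]
              ring_nf
              simp
    _ = _ := by rw [mul_one]
end
end

section
/- Let 0 < γ < mn, take γ_i = γ/m for every i, let p⃗ be a vector of exponents, and set τ = (γ-mn)(1-1/m)+1/m. Suppose γ - mn < δ = τ < γ - n/p. Set β_i = 0 for i ∈ I_1, choose for each i ∈ I_2 any β_i with (γ-τ)/m - n/p_i < β_i < n/p_i', and put α = Σ_{i=1}^m β_i + τ - γ + n/p. Then the pair (w,v⃗) with w(x) = |x|^α and v_i(x) = |x|^{β_i} belongs to ℍ_m(p⃗,γ,τ). -/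
open MeasureTheory Metric Set
open scoped ENNReal NNReal BigOperators Classical

noncomputable section

lemma polar_aux {n : ℕ} (hn : 1 ≤ n) (c : ℝ) (s : Set ℝ) (hs : MeasurableSet s)
    (hint : IntegrableOn (fun t : ℝ => t ^ ((n : ℝ) - 1 - c)) (s ∩ Ioi 0)) :
    ∫⁻ y in {y : Rn n | ‖y‖ ∈ s}, ENNReal.ofReal (‖y‖ ^ (-c)) =
      ENNReal.ofReal (n * (volume.real (ball (0 : Rn n) 1) *
        ∫ t in s ∩ Ioi 0, t ^ ((n : ℝ) - 1 - c))) := by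
  have : Nonempty (Fin n) := ⟨⟨0, hn⟩⟩
  have : Nontrivial (Rn n) := by infer_instance
  set f : ℝ → ℝ := s.indicator (fun t => t ^ (-c)) with hf
  have hfin : Module.finrank ℝ (Rn n) = n := by simp
  have key : ∀ t ∈ Ioi (0 : ℝ), t ^ (n - 1) • f t =
      s.indicator (fun t : ℝ => t ^ ((n : ℝ) - 1 - c)) t := by
    intro t ht
    have ht' : (0 : ℝ) < t := ht
    by_cases h : t ∈ s
    · simp only [hf, indicator_of_mem h, smul_eq_mul]
      rw [← Real.rpow_natCast, ← Real.rpow_add ht', Nat.cast_sub hn]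
      congr 1
      push_cast
      ring
    · simp [hf, indicator_of_notMem h]
  have hI : Integrable (fun y : Rn n => f ‖y‖) volume := by
    rw [integrable_fun_norm_addHaar volume (f := f), hfin,
      integrableOn_congr_fun key measurableSet_Ioi]
    rw [IntegrableOn, integrable_indicator_iff hs, IntegrableOn, Measure.restrict_restrict hs]
    exact hint
  have hset : MeasurableSet {y : Rn n | ‖y‖ ∈ s} := measurable_norm hs
  have h1 : ∫⁻ y in {y : Rn n | ‖y‖ ∈ s}, ENNReal.ofReal (‖y‖ ^ (-c)) =
      ∫⁻ y : Rn n, ENNReal.ofReal (f ‖y‖) := by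
    rw [← lintegral_indicator hset]
    refine lintegral_congr fun y => ?_
    by_cases h : ‖y‖ ∈ s
    · simp [hf, indicator, h]
    · simp [hf, indicator, h]
  rw [h1, ← ofReal_integral_eq_lintegral_ofReal hI, integral_fun_norm_addHaar volume f, hfin,
    setIntegral_congr_fun measurableSet_Ioi key, integral_indicator hs,
    Measure.restrict_restrict hs]
  · simp
  · refine Filter.Eventually.of_forall fun y => ?_
    simp only [hf, indicator, Pi.zero_apply]
    split_ifs
    · positivity
    · exact le_rfl

lemma near_aux {n : ℕ} (hn : 1 ≤ n) (c : ℝ) (hc : c < n) :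
    ∃ K : ℝ, 0 ≤ K ∧ ∀ (x : Rn n) (ρ : ℝ), 0 < ρ →
      ∫⁻ y in ball x ρ, ENNReal.ofReal (dist x y ^ (-c)) ≤
        ENNReal.ofReal (K * ρ ^ ((n : ℝ) - c)) := by
  refine ⟨n * (volume.real (ball (0 : Rn n) 1) * (1 / (n - c))), ?_, ?_⟩
  · have : (0 : ℝ) < n - c := by linarith
    positivity
  intro x ρ hρ
  have h0 : ∫⁻ y in ball x ρ, ENNReal.ofReal (dist x y ^ (-c)) =
      ∫⁻ y in {y : Rn n | ‖y‖ ∈ Iio ρ}, ENNReal.ofReal (‖y‖ ^ (-c)) := by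
    have hset : MeasurableSet {y : Rn n | ‖y‖ ∈ Iio ρ} := measurable_norm measurableSet_Iio
    rw [← lintegral_indicator measurableSet_ball, ← lintegral_indicator hset,
      ← lintegral_add_right_eq_self _ x]
    refine lintegral_congr fun y => ?_
    simp [indicator, dist_eq_norm]
  have hS : Iio ρ ∩ Ioi 0 = Ioo 0 ρ := by
    ext; simp [and_comm]
  have hi := (intervalIntegral.intervalIntegrable_rpow' (a := 0) (b := ρ)
    (r := (n : ℝ) - 1 - c) (by linarith))
  rw [intervalIntegrable_iff_integrableOn_Ioo_of_le hρ.le] at hi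
  rw [h0, polar_aux hn c _ measurableSet_Iio (by rw [hS]; exact hi), hS,
    ← integral_Ioc_eq_integral_Ioo, ← intervalIntegral.integral_of_le hρ.le,
    integral_rpow (Or.inl (by linarith)), Real.zero_rpow (by linarith)]
  apply le_of_eq
  congr 1
  rw [show (n : ℝ) - 1 - c + 1 = n - c by ring]
  ring

lemma far_aux {n : ℕ} (hn : 1 ≤ n) (c : ℝ) (hc : n < c) :
    ∃ K : ℝ, 0 ≤ K ∧ ∀ (ρ : ℝ), 0 < ρ →
      ∫⁻ y in (ball (0 : Rn n) ρ)ᶜ, ENNReal.ofReal (‖y‖ ^ (-c)) ≤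
        ENNReal.ofReal (K * ρ ^ ((n : ℝ) - c)) := by
  refine ⟨n * (volume.real (ball (0 : Rn n) 1) * (1 / (c - n))), ?_, ?_⟩
  · have : (0 : ℝ) < c - n := by linarith
    positivity
  intro ρ hρ
  have h0 : (ball (0 : Rn n) ρ)ᶜ = {y : Rn n | ‖y‖ ∈ Ici ρ} := by
    ext; simp
  have hS : Ici ρ ∩ Ioi 0 = Ici ρ := by
    ext y; simp; intro h; linarith
  have hi := integrableOn_Ioi_rpow_of_lt (a := (n : ℝ) - 1 - c) (by linarith) hρ
  rw [← integrableOn_Ici_iff_integrableOn_Ioi] at hi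
  rw [h0, polar_aux hn c _ measurableSet_Ici (by rw [hS]; exact hi), hS,
    integral_Ici_eq_integral_Ioi, integral_Ioi_rpow_of_lt (by linarith) hρ]
  apply le_of_eq
  congr 1
  rw [show (n : ℝ) - 1 - c + 1 = -(c - n) by ring, show (n : ℝ) - c = -(c - n) by ring, neg_div_neg_eq]
  ring

lemma conjE_facts (p : ℝ≥0∞) (hp : 1 ≤ p) :
    ((conjE p)⁻¹).toReal = 1 - (p⁻¹).toReal ∧
      (p ≠ 1 → conjE p ≠ ∞ ∧ 0 < (conjE p).toReal) ∧ (p = 1 → conjE p = ∞) := by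
  unfold conjE
  by_cases h1 : p = 1
  · subst h1; simp
  by_cases h2 : p = ∞
  · subst h2; simp
  have h3 : 1 < p.toReal := by
    have : 1 < p := lt_of_le_of_ne hp (Ne.symm h1)
    have := (ENNReal.toReal_lt_toReal (by simp) h2).2 this
    simpa using this
  have h4 : 0 < p.toReal / (p.toReal - 1) := div_pos (by linarith) (by linarith)
  simp only [h1, h2, if_false, ENNReal.toReal_inv, ENNReal.toReal_ofReal h4.le]
  refine ⟨?_, fun _ => ⟨by simp, h4⟩, fun h => absurd h (by simp)⟩
  have : p.toReal - 1 ≠ 0 := by linarith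
  field_simp

lemma fac_aux {n : ℕ} (hn : 1 ≤ n) (q β lam μ : ℝ) (hq : 0 < q) (hβ : β * q < n)
    (hinf : n < (β + lam) * q) (hμ0 : 0 ≤ μ) (hμl : μ ≤ lam) (hμ : μ * q < n) :
    ∃ K : ℝ, 0 ≤ K ∧ ∀ (x : Rn n) (r : ℝ), 0 < r →
      ∫⁻ y : Rn n, ((ENNReal.ofReal (‖y‖ ^ β))⁻¹ *
        (ENNReal.ofReal r + edist x y) ^ (-lam)) ^ q ≤
      ENNReal.ofReal (K * (r ^ (μ - lam) * (r + ‖x‖) ^ (n / q - β - μ)) ^ q) := by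
  obtain ⟨K1, hK1, H1⟩ := near_aux hn (β * q) hβ
  obtain ⟨K2, hK2, H2⟩ := near_aux hn (μ * q) hμ
  obtain ⟨K3, hK3, H3⟩ := far_aux hn ((β + lam) * q) hinf
  have hlam : 0 ≤ lam := hμ0.trans hμl
  set A1 : ℝ := K1 * (1 / 2) ^ ((n : ℝ) - β * q) * (1 / 2) ^ (-(lam * q)) with hA1
  set A2 : ℝ := (4 : ℝ) ^ (|β| * q) * (K2 * 3 ^ ((n : ℝ) - μ * q)) with hA2
  set A3 : ℝ := (1 / 2) ^ (-(lam * q)) * (K3 * 2 ^ ((n : ℝ) - (β + lam) * q)) with hA3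
  have hA1' : 0 ≤ A1 := by positivity
  have hA2' : 0 ≤ A2 := by positivity
  have hA3' : 0 ≤ A3 := by positivity
  refine ⟨A1 + A2 + A3, by positivity, ?_⟩
  intro x r hr
  set S : ℝ := r + ‖x‖ with hS
  have hSr : r ≤ S := by simp [hS]
  have hSpos : 0 < S := hr.trans_le hSr
  have hxS : ‖x‖ ≤ S := by simp [hS, hr.le]
  set T : ℝ := r ^ ((μ - lam) * q) * S ^ ((n : ℝ) - β * q - μ * q) with hT
  have hTeq : (r ^ (μ - lam) * S ^ (n / q - β - μ)) ^ q = T := by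
    rw [Real.mul_rpow (by positivity) (by positivity), ← Real.rpow_mul hr.le,
      ← Real.rpow_mul hSpos.le, hT]
    congr 2
    field_simp
  rw [hTeq]
  have hTpos : 0 ≤ T := by positivity
  have hST : S ^ ((n : ℝ) - (β + lam) * q) ≤ T := by
    have : S ^ ((n : ℝ) - (β + lam) * q) =
        S ^ ((μ - lam) * q) * S ^ ((n : ℝ) - β * q - μ * q) := by
      rw [← Real.rpow_add hSpos]; congr 1; ring
    rw [this, hT]
    refine mul_le_mul_of_nonneg_right ?_ (by positivity)
    exact Real.rpow_le_rpow_of_nonpos hr hSr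
      (mul_nonpos_of_nonpos_of_nonneg (by linarith) hq.le)
  -- pointwise form
  have hpt : ∀ y : Rn n, y ≠ 0 → ((ENNReal.ofReal (‖y‖ ^ β))⁻¹ *
        (ENNReal.ofReal r + edist x y) ^ (-lam)) ^ q =
        ENNReal.ofReal (‖y‖ ^ (-(β * q)) * (r + dist x y) ^ (-(lam * q))) := by
    intro y hy
    have hy' : 0 < ‖y‖ := norm_pos_iff.2 hy
    have hd : 0 < r + dist x y := by positivity
    rw [← ENNReal.ofReal_inv_of_pos (by positivity), edist_dist,
      ← ENNReal.ofReal_add hr.le dist_nonneg, ENNReal.ofReal_rpow_of_pos hd,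
      ← ENNReal.ofReal_mul (by positivity), ENNReal.ofReal_rpow_of_pos (by positivity),
      Real.mul_rpow (by positivity) (by positivity), ← Real.rpow_neg hy'.le,
      ← Real.rpow_mul hy'.le, ← Real.rpow_mul hd.le, neg_mul, neg_mul]
  have hae : ∀ᵐ y : Rn n, y ≠ 0 := by
    have : Nonempty (Fin n) := ⟨⟨0, hn⟩⟩
    have : Nontrivial (Rn n) := by infer_instance
    simp [ae_iff]
  rw [lintegral_congr_ae (hae.mono fun y hy => hpt y hy)]
  set F : Rn n → ℝ≥0∞ := fun y =>
    ENNReal.ofReal (‖y‖ ^ (-(β * q)) * (r + dist x y) ^ (-(lam * q))) with hF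
  have hlq : -(lam * q) ≤ 0 := by
    have := mul_nonneg hlam hq.le
    linarith
  -- region near the origin
  have R1 : ∫⁻ y in ball (0 : Rn n) (1 / 2 * S), F y ≤ ENNReal.ofReal (A1 * T) := by
    calc ∫⁻ y in ball (0 : Rn n) (1 / 2 * S), F y
        ≤ ∫⁻ y in ball (0 : Rn n) (1 / 2 * S),
            ENNReal.ofReal ((1 / 2 * S) ^ (-(lam * q))) *
              ENNReal.ofReal (dist 0 y ^ (-(β * q))) := by
          refine setLIntegral_mono' measurableSet_ball fun y hy => ?_
          rw [← ENNReal.ofReal_mul (by positivity), hF, dist_zero_left]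
          refine ENNReal.ofReal_le_ofReal ?_
          rw [mul_comm]
          refine mul_le_mul_of_nonneg_right ?_ (by positivity)
          refine Real.rpow_le_rpow_of_nonpos (by positivity) ?_ hlq
          have h1 : ‖y‖ < 1 / 2 * S := by simpa using hy
          have h2 : ‖x‖ ≤ dist x y + ‖y‖ := by
            rw [dist_eq_norm]; simpa using norm_add_le (x - y) y
          linarith
      _ = ENNReal.ofReal ((1 / 2 * S) ^ (-(lam * q))) *
            ∫⁻ y in ball (0 : Rn n) (1 / 2 * S), ENNReal.ofReal (dist 0 y ^ (-(β * q))) :=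
          lintegral_const_mul' _ _ ENNReal.ofReal_ne_top
      _ ≤ ENNReal.ofReal ((1 / 2 * S) ^ (-(lam * q))) *
            ENNReal.ofReal (K1 * (1 / 2 * S) ^ ((n : ℝ) - β * q)) := by
          gcongr
          exact H1 0 _ (by positivity)
      _ = ENNReal.ofReal (A1 * S ^ ((n : ℝ) - (β + lam) * q)) := by
          rw [← ENNReal.ofReal_mul (by positivity)]
          congr 1
          rw [Real.mul_rpow (by positivity) hSpos.le, Real.mul_rpow (by positivity) hSpos.le,
            show (n : ℝ) - (β + lam) * q = -(lam * q) + (n - β * q) by ring,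
            Real.rpow_add hSpos, hA1]
          ring
      _ ≤ ENNReal.ofReal (A1 * T) := by gcongr
  -- far region
  have R3 : ∫⁻ y in (ball (0 : Rn n) (2 * S))ᶜ, F y ≤ ENNReal.ofReal (A3 * T) := by
    calc ∫⁻ y in (ball (0 : Rn n) (2 * S))ᶜ, F y
        ≤ ∫⁻ y in (ball (0 : Rn n) (2 * S))ᶜ,
            ENNReal.ofReal ((1 / 2) ^ (-(lam * q))) *
              ENNReal.ofReal (‖y‖ ^ (-((β + lam) * q))) := by
          refine setLIntegral_mono' measurableSet_ball.compl fun y hy => ?_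
          have h1 : 2 * S ≤ ‖y‖ := by simpa using hy
          have hy' : 0 < ‖y‖ := by linarith
          rw [← ENNReal.ofReal_mul (by positivity), hF]
          refine ENNReal.ofReal_le_ofReal ?_
          have : (1 / 2 : ℝ) ^ (-(lam * q)) * ‖y‖ ^ (-((β + lam) * q)) =
              ‖y‖ ^ (-(β * q)) * (1 / 2 * ‖y‖) ^ (-(lam * q)) := by
            rw [Real.mul_rpow (by positivity) hy'.le,
              show -((β + lam) * q) = -(β * q) + -(lam * q) by ring, Real.rpow_add hy']
            ring
          rw [this]
          refine mul_le_mul_of_nonneg_left ?_ (by positivity)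
          refine Real.rpow_le_rpow_of_nonpos (by positivity) ?_ hlq
          have h2 : ‖y‖ ≤ dist x y + ‖x‖ := by
            rw [dist_comm, dist_eq_norm]; simpa using norm_add_le (y - x) x
          linarith
      _ = ENNReal.ofReal ((1 / 2) ^ (-(lam * q))) *
            ∫⁻ y in (ball (0 : Rn n) (2 * S))ᶜ, ENNReal.ofReal (‖y‖ ^ (-((β + lam) * q))) :=
          lintegral_const_mul' _ _ ENNReal.ofReal_ne_top
      _ ≤ ENNReal.ofReal ((1 / 2) ^ (-(lam * q))) *
            ENNReal.ofReal (K3 * (2 * S) ^ ((n : ℝ) - (β + lam) * q)) := by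
          gcongr
          exact H3 _ (by positivity)
      _ = ENNReal.ofReal (A3 * S ^ ((n : ℝ) - (β + lam) * q)) := by
          rw [← ENNReal.ofReal_mul (by positivity)]
          congr 1
          rw [Real.mul_rpow (by positivity) hSpos.le, hA3]
          ring
      _ ≤ ENNReal.ofReal (A3 * T) := by gcongr
  -- middle region
  set M : Set (Rn n) := (ball (0 : Rn n) (2 * S)) \ (ball (0 : Rn n) (1 / 2 * S)) with hM
  have hMm : MeasurableSet M := measurableSet_ball.diff measurableSet_ball
  have R2 : ∫⁻ y in M, F y ≤ ENNReal.ofReal (A2 * T) := by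
    calc ∫⁻ y in M, F y
        ≤ ∫⁻ y in M, ENNReal.ofReal (4 ^ (|β| * q) * S ^ (-(β * q)) * r ^ ((μ - lam) * q)) *
              ENNReal.ofReal (dist x y ^ (-(μ * q))) := by
          have hae' : ∀ᵐ y : Rn n, y ≠ x := by
            have : Nonempty (Fin n) := ⟨⟨0, hn⟩⟩
            have : Nontrivial (Rn n) := by infer_instance
            simp [ae_iff]
          refine setLIntegral_mono_ae' hMm (hae'.mono fun y hyx hy => ?_)
          have hd : 0 < dist x y := dist_pos.2 (Ne.symm hyx)
          have h1 : ‖y‖ < 2 * S := by simpa using hy.1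
          have h2 : 1 / 2 * S ≤ ‖y‖ := by simpa using hy.2
          have hy' : 0 < ‖y‖ := by linarith
          rw [← ENNReal.ofReal_mul (by positivity), hF]
          refine ENNReal.ofReal_le_ofReal ?_
          rw [mul_assoc (_ * _)]
          refine mul_le_mul ?_ ?_ (by positivity) (by positivity)
          · rcases le_total 0 β with hb | hb
            · rw [abs_of_nonneg hb]
              calc ‖y‖ ^ (-(β * q)) ≤ (4⁻¹ * S) ^ (-(β * q)) := by
                    refine Real.rpow_le_rpow_of_nonpos (by positivity) (by linarith) ?_
                    have := mul_nonneg hb hq.le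
                    linarith
                _ = _ := by
                    rw [Real.mul_rpow (by positivity) hSpos.le, Real.inv_rpow (by positivity),
                      Real.rpow_neg (by positivity), inv_inv]
            · rw [abs_of_nonpos hb]
              calc ‖y‖ ^ (-(β * q)) ≤ (4 * S) ^ (-(β * q)) := by
                    refine Real.rpow_le_rpow hy'.le (by linarith) ?_
                    have := mul_nonpos_of_nonpos_of_nonneg hb hq.le
                    linarith
                _ = _ := by
                    rw [Real.mul_rpow (by positivity) hSpos.le, neg_mul]
          · rw [show -(lam * q) = (μ - lam) * q + -(μ * q) by ring, Real.rpow_add (by positivity)]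
            refine mul_le_mul ?_ ?_ (by positivity) (by positivity)
            · exact Real.rpow_le_rpow_of_nonpos hr (by linarith)
                (mul_nonpos_of_nonpos_of_nonneg (by linarith) hq.le)
            · refine Real.rpow_le_rpow_of_nonpos hd (by linarith) ?_
              have := mul_nonneg hμ0 hq.le
              linarith
      _ ≤ ∫⁻ y in ball x (3 * S),
            ENNReal.ofReal (4 ^ (|β| * q) * S ^ (-(β * q)) * r ^ ((μ - lam) * q)) *
              ENNReal.ofReal (dist x y ^ (-(μ * q))) := by
          refine lintegral_mono_set fun y hy => ?_
          have h1 : ‖y‖ < 2 * S := by simpa using hy.1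
          rw [mem_ball, dist_eq_norm]
          have := norm_sub_le y x
          linarith
      _ = ENNReal.ofReal (4 ^ (|β| * q) * S ^ (-(β * q)) * r ^ ((μ - lam) * q)) *
            ∫⁻ y in ball x (3 * S), ENNReal.ofReal (dist x y ^ (-(μ * q))) :=
          lintegral_const_mul' _ _ ENNReal.ofReal_ne_top
      _ ≤ ENNReal.ofReal (4 ^ (|β| * q) * S ^ (-(β * q)) * r ^ ((μ - lam) * q)) *
            ENNReal.ofReal (K2 * (3 * S) ^ ((n : ℝ) - μ * q)) := by
          gcongr
          exact H2 x _ (by positivity)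
      _ = ENNReal.ofReal (A2 * T) := by
          rw [← ENNReal.ofReal_mul (by positivity)]
          congr 1
          rw [Real.mul_rpow (by positivity) hSpos.le, hA2, hT,
            show (n : ℝ) - β * q - μ * q = -(β * q) + (n - μ * q) by ring, Real.rpow_add hSpos]
          ring
  have hcover : (univ : Set (Rn n)) ⊆
      (ball (0 : Rn n) (1 / 2 * S) ∪ M) ∪ (ball (0 : Rn n) (2 * S))ᶜ := by
    intro y _
    by_cases h1 : y ∈ ball (0 : Rn n) (1 / 2 * S)
    · exact Or.inl (Or.inl h1)
    by_cases h2 : y ∈ ball (0 : Rn n) (2 * S)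
    · exact Or.inl (Or.inr ⟨h2, h1⟩)
    · exact Or.inr h2
  calc ∫⁻ y, F y = ∫⁻ y in univ, F y := by rw [setLIntegral_univ]
    _ ≤ ∫⁻ y in (ball (0 : Rn n) (1 / 2 * S) ∪ M) ∪ (ball (0 : Rn n) (2 * S))ᶜ, F y :=
        lintegral_mono_set hcover
    _ ≤ ((∫⁻ y in ball (0 : Rn n) (1 / 2 * S), F y) + (∫⁻ y in M, F y)) +
          ∫⁻ y in (ball (0 : Rn n) (2 * S))ᶜ, F y := by
        refine (lintegral_union_le _ _ _).trans ?_
        exact add_le_add (lintegral_union_le _ _ _) le_rfl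
    _ ≤ ENNReal.ofReal (A1 * T) + ENNReal.ofReal (A2 * T) + ENNReal.ofReal (A3 * T) :=
        add_le_add (add_le_add R1 R2) R3
    _ = ENNReal.ofReal ((A1 + A2 + A3) * T) := by
        rw [← ENNReal.ofReal_add (by positivity) (by positivity),
          ← ENNReal.ofReal_add (by positivity) (by positivity)]
        congr 1
        ring

lemma factor_bound {n : ℕ} (hn : 1 ≤ n) (p : ℝ≥0∞) (hp : 1 ≤ p) (β lam μ a : ℝ)
    (ha : a = n * ((conjE p)⁻¹).toReal) (hμ0 : 0 ≤ μ) (hμl : μ ≤ lam)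
    (h1 : p = 1 → β = 0 ∧ μ = 0) (h2 : p ≠ 1 → a < β + lam ∧ β < a ∧ μ < a) :
    ∃ K : ℝ, 0 ≤ K ∧ ∀ (x : Rn n) (r : ℝ), 0 < r →
      lpOn (conjE p) (fun y : Rn n => (ENNReal.ofReal (‖y‖ ^ β))⁻¹ *
        (ENNReal.ofReal r + edist x y) ^ (-lam)) univ ≤
      ENNReal.ofReal (K * (r ^ (μ - lam) * (r + ‖x‖) ^ (a - β - μ))) := by
  obtain ⟨-, hc2, hc3⟩ := conjE_facts p hp
  by_cases hp1 : p = 1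
  · obtain ⟨rfl, rfl⟩ := h1 hp1
    have hcp := hc3 hp1
    rw [hcp] at ha ⊢
    have ha0 : a = 0 := by simpa using ha
    subst ha0
    refine ⟨1, zero_le_one, fun x r hr => ?_⟩
    unfold lpOn
    rw [if_pos rfl]
    refine essSup_le_of_ae_le _ (Filter.Eventually.of_forall fun y => ?_)
    have hd : 0 < r + dist x y := by positivity
    simp only [Real.rpow_zero, ENNReal.ofReal_one, inv_one, one_mul, sub_zero, mul_one, zero_sub]
    rw [edist_dist, ← ENNReal.ofReal_add hr.le dist_nonneg, ENNReal.ofReal_rpow_of_pos hd]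
    refine ENNReal.ofReal_le_ofReal ?_
    exact Real.rpow_le_rpow_of_nonpos hr (by linarith [dist_nonneg (x := x) (y := y)]) (by linarith)
  · obtain ⟨hq1, hq⟩ := hc2 hp1
    obtain ⟨g1, g2, g3⟩ := h2 hp1
    set q := (conjE p).toReal with hqdef
    have haq : a = n / q := by
      rw [ha, ENNReal.toReal_inv, ← hqdef]; rfl
    have haq' : a * q = n := by rw [haq]; field_simp
    obtain ⟨K, hK, H⟩ := fac_aux hn q β lam μ hq
      (by rw [← haq']; exact mul_lt_mul_of_pos_right g2 hq)
      (by rw [← haq']; exact mul_lt_mul_of_pos_right g1 hq) hμ0 hμl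
      (by rw [← haq']; exact mul_lt_mul_of_pos_right g3 hq)
    refine ⟨K ^ (1 / q), by positivity, fun x r hr => ?_⟩
    unfold lpOn
    rw [if_neg hq1, ← hqdef, setLIntegral_univ]
    refine (ENNReal.rpow_le_rpow (H x r hr) (by positivity)).trans ?_
    have hS : 0 < r + ‖x‖ := by positivity
    rw [ENNReal.ofReal_rpow_of_nonneg (by positivity) (by positivity),
      Real.mul_rpow hK (by positivity), one_div, Real.rpow_rpow_inv (by positivity) hq.ne', ← haq]

/-- power-weight examples at the point `δ = τ` when
`γ - mn < τ < γ - n/p`. -/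
theorem statement15 {n m : ℕ} (hn : 1 ≤ n) (hm : 1 ≤ m) (γ τ : ℝ) (hγ0 : 0 < γ)
    (hγ : γ < m * n) (p : Fin m → ℝ≥0∞) (hp : ∀ i, 1 ≤ p i)
    (hτ : τ = (γ - m * n) * (1 - 1 / (m : ℝ)) + 1 / (m : ℝ))
    (hδ1 : γ - m * n < τ) (hδ2 : τ < γ - n * ∑ i, ((p i)⁻¹).toReal)
    (β : Fin m → ℝ)
    (hβ1 : ∀ i, p i = 1 → β i = 0)
    (hβ2 : ∀ i, p i ≠ 1 →
      (γ - τ) / m - (n : ℝ) * ((p i)⁻¹).toReal < β i ∧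
        β i < (n : ℝ) * ((conjE (p i))⁻¹).toReal)
    (α : ℝ) (hα : α = (∑ i, β i) + τ - γ + n * ∑ i, ((p i)⁻¹).toReal) :
    Hm m (fun _ => γ / m) τ p (fun x : Rn n => ENNReal.ofReal (‖x‖ ^ α))
      (fun (i : Fin m) (x : Rn n) => ENNReal.ofReal (‖x‖ ^ β i)) := by
  have hm0 : (0 : ℝ) < m := by exact_mod_cast hm
  have hn0 : (0 : ℝ) < n := by exact_mod_cast hn
  set lam : ℝ := (n : ℝ) - γ / m + 1 / m with hlam
  have hlam0 : 0 < lam := by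
    have : γ / m < n := by rw [div_lt_iff₀ hm0]; linarith
    have : (0 : ℝ) < 1 / m := by positivity
    linarith
  have hl1 : lam = τ - γ + m * n := by
    rw [hlam, hτ]; field_simp; ring
  have hl2 : 1 - τ = (m - 1) * lam := by
    rw [hlam, hτ]; field_simp; ring
  set a : Fin m → ℝ := fun i => n * ((conjE (p i))⁻¹).toReal with ha
  have ha1 : ∀ i, a i = n - n * ((p i)⁻¹).toReal := by
    intro i
    simp only [ha, (conjE_facts (p i) (hp i)).1]
    ring
  have ha0 : ∀ i, 0 ≤ a i := fun i => by positivity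
  have hsum : ∑ i, a i = m * n - n * ∑ i, ((p i)⁻¹).toReal := by
    simp only [ha1, Finset.sum_sub_distrib, Finset.mul_sum]
    simp
  have hsl : lam < ∑ i, a i := by rw [hsum]; linarith
  have hs0 : 0 < ∑ i, a i := hlam0.trans hsl
  set μ : Fin m → ℝ := fun i => lam * a i / ∑ j, a j with hμ
  have hμsum : ∑ i, μ i = lam := by
    simp only [hμ, ← Finset.sum_div, ← Finset.mul_sum]
    field_simp
  have hμ0 : ∀ i, 0 ≤ μ i := fun i =>
    div_nonneg (mul_nonneg hlam0.le (ha0 i)) hs0.le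
  have hμl : ∀ i, μ i ≤ lam := by
    intro i
    rw [← hμsum]
    exact Finset.single_le_sum (fun j _ => hμ0 j) (Finset.mem_univ i)
  have hap : ∀ i, p i = 1 → a i = 0 := by
    intro i h
    simp [ha1, h]
  have hgl : (γ - τ) / m = n - lam / m := by
    rw [hl1]; field_simp; ring
  have hlm : lam / m ≤ lam := div_le_self hlam0.le (by exact_mod_cast hm)
  have hb : ∀ i, a i - lam / m < β i := by
    intro i
    by_cases h : p i = 1
    · rw [hβ1 i h, hap i h]
      have : 0 < lam / m := by positivity
      linarith
    · have := (hβ2 i h).1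
      rw [hgl] at this
      rw [ha1]; linarith
  have hfac : ∀ i, ∃ K : ℝ, 0 ≤ K ∧ ∀ (x : Rn n) (r : ℝ), 0 < r →
      lpOn (conjE (p i)) (fun y : Rn n => (ENNReal.ofReal (‖y‖ ^ β i))⁻¹ *
        (ENNReal.ofReal r + edist x y) ^ (-lam)) univ ≤
      ENNReal.ofReal (K * (r ^ (μ i - lam) * (r + ‖x‖) ^ (a i - β i - μ i))) := by
    intro i
    refine factor_bound hn (p i) (hp i) (β i) lam (μ i) (a i) rfl (hμ0 i) (hμl i) ?_ ?_
    · intro h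
      exact ⟨hβ1 i h, by simp [hμ, hap i h]⟩
    · intro h
      have h3 := (hβ2 i h).2
      have h4 : 0 < a i := by
        have h5 : 1 < p i := lt_of_le_of_ne (hp i) (Ne.symm h)
        have h6 := (conjE_facts (p i) (hp i)).2.1 h
        simp only [ha, ENNReal.toReal_inv]
        have := h6.2
        positivity
      refine ⟨by linarith [hb i], h3, ?_⟩
      simp only [hμ]
      rw [div_lt_iff₀ hs0, mul_comm]
      exact mul_lt_mul_of_pos_left hsl h4
  choose K hK H using hfac
  have hα2 : α = (∑ i, (β i - a i)) + lam := by
    rw [hα, Finset.sum_sub_distrib, hsum, hl1]; ring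
  have hα0 : 0 ≤ α := by
    have h1 : ∑ _i : Fin m, (-(lam / m)) ≤ ∑ i, (β i - a i) :=
      Finset.sum_le_sum fun i _ => by linarith [hb i]
    have h2 : ∑ _i : Fin m, (-(lam / m)) = -lam := by
      simp; field_simp
    rw [hα2]; linarith
  have : Nonempty (Fin n) := ⟨⟨0, hn⟩⟩
  have : Nontrivial (Rn n) := by infer_instance
  set V : ℝ := volume.real (ball (0 : Rn n) 1) with hV
  have hVpos : 0 < V := by
    rw [hV, measureReal_def]
    exact ENNReal.toReal_pos (measure_ball_pos volume _ one_pos).ne' measure_ball_lt_top.ne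
  set c : ℝ := V ^ ((n : ℝ)⁻¹) with hc
  have hcpos : 0 < c := by positivity
  have hvol : ∀ (x : Rn n) (R : ℝ), 0 < R →
      volume (ball x R) = ENNReal.ofReal ((c * R) ^ (n : ℝ)) := by
    intro x R hR
    rw [Measure.addHaar_ball volume x hR.le, Real.mul_rpow hcpos.le hR.le, hc,
      Real.rpow_inv_rpow hVpos.le hn0.ne', mul_comm, ENNReal.ofReal_mul hVpos.le, hV,
      ofReal_measureReal measure_ball_lt_top.ne, Real.rpow_natCast]
    simp
  have hvolp : ∀ (x : Rn n) (R s : ℝ), 0 < R →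
      volume (ball x R) ^ (s / n) = ENNReal.ofReal ((c * R) ^ s) := by
    intro x R s hR
    rw [hvol x R hR, ENNReal.ofReal_rpow_of_pos (by positivity), ← Real.rpow_mul (by positivity)]
    congr 2
    field_simp
  set D : ℝ := 1 + c⁻¹ with hD
  have hDpos : 0 < D := by positivity
  refine ⟨D ^ α * (∏ i, K i) + 1, ?_, ?_⟩
  · have := Finset.prod_nonneg (fun i (_ : i ∈ Finset.univ) => hK i)
    positivity
  intro x R hR
  set r : ℝ := c * R with hr
  have hrpos : 0 < r := by positivity
  set S : ℝ := r + ‖x‖ with hS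
  have hSpos : 0 < S := by positivity
  have hw : essSup (fun x : Rn n => ENNReal.ofReal (‖x‖ ^ α)) (volume.restrict (ball x R)) ≤
      ENNReal.ofReal (D ^ α * S ^ α) := by
    refine essSup_le_of_ae_le _ ?_
    filter_upwards [ae_restrict_mem measurableSet_ball] with y hy
    refine ENNReal.ofReal_le_ofReal ?_
    rw [← Real.mul_rpow hDpos.le hSpos.le]
    refine Real.rpow_le_rpow (norm_nonneg _) ?_ hα0
    have h1 : ‖y‖ ≤ dist y x + ‖x‖ := by
      rw [dist_eq_norm]; simpa using norm_add_le (y - x) x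
    have h2 : dist y x < R := hy
    have h3 : D * S = r + ‖x‖ + R + c⁻¹ * ‖x‖ := by
      rw [hD, hS, hr]; field_simp; ring
    rw [h3]
    have : 0 ≤ c⁻¹ * ‖x‖ := by positivity
    linarith
  have hF : ∀ i, HmFactor m (γ / m) (conjE (p i))
      (fun x : Rn n => ENNReal.ofReal (‖x‖ ^ β i)) x R ≤
      ENNReal.ofReal (K i * (r ^ (μ i - lam) * S ^ (a i - β i - μ i))) := by
    intro i
    have h := H i x r hrpos
    unfold HmFactor
    rw [← hlam]
    have h1 := hvolp x R 1 hR
    rw [one_div, Real.rpow_one] at h1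
    rw [h1]
    exact h
  have hvτ : volume (ball x R) ^ (-((τ - 1) / (n : ℝ))) = ENNReal.ofReal (r ^ (1 - τ)) := by
    rw [← neg_div, hvolp x R _ hR, neg_sub]
  have hprod : ∏ i, (K i * (r ^ (μ i - lam) * S ^ (a i - β i - μ i))) =
      (∏ i, K i) * (r ^ (-(1 - τ)) * S ^ (-α)) := by
    rw [Finset.prod_mul_distrib, Finset.prod_mul_distrib, ← Real.rpow_sum_of_pos hrpos,
      ← Real.rpow_sum_of_pos hSpos]
    congr 3
    · rw [Finset.sum_sub_distrib, hμsum, hl2]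
      simp
      ring
    · rw [Finset.sum_sub_distrib, hμsum, hα2, Finset.sum_sub_distrib, Finset.sum_sub_distrib]
      ring
  calc _ ≤ ENNReal.ofReal (D ^ α * S ^ α) * ENNReal.ofReal (r ^ (1 - τ)) *
        ∏ i, ENNReal.ofReal (K i * (r ^ (μ i - lam) * S ^ (a i - β i - μ i))) := by
        rw [hvτ]
        exact mul_le_mul' (mul_le_mul' hw le_rfl) (Finset.prod_le_prod' fun i _ => hF i)
    _ = ENNReal.ofReal (D ^ α * (∏ i, K i)) := by
        rw [← ENNReal.ofReal_prod_of_nonneg, hprod, ← ENNReal.ofReal_mul (by positivity),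
          ← ENNReal.ofReal_mul (by positivity), Real.rpow_neg hrpos.le, Real.rpow_neg hSpos.le]
        · congr 1
          have := Real.rpow_pos_of_pos hrpos (1 - τ)
          have := Real.rpow_pos_of_pos hSpos α
          field_simp
        · intro i _
          have := hK i
          positivity
    _ ≤ _ := ENNReal.ofReal_le_ofReal (by linarith)
end
end
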